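/- For every ε > 0 there exist η > 0 and x₀ ≥ 3 such that for all real x ≥ x₀, all integers k with 1 ≤ k ≤ η·√(log₂x), and all reals 2 ≤ P < Q ≤ x, the number of integers n ∈ (x, 2x] with ω(n) = k and gcd(n, ∏_{P < p ≤ Q} p) = 1 is at most (1 + ε)·δ_k(x)·x·(log P / log Q)^κ, where κ := (k−1)/log₂x. -/

import Mathlib

open scoped Classical BigOperators
open MeasureTheory

/-- Number of distinct prime factors. -/
noncomputable def smallOmega (n : ℕ) : ℕ := n.primeFactors.card

/-- `π_k(x)`: number of integers `n ≤ x` with `ω(n) = k`. -/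
noncomputable def pik (k : ℕ) (x : ℝ) : ℕ :=
  ((Finset.Icc 1 ⌊x⌋₊).filter (fun n => smallOmega n = k)).card

/-- Iterated logarithm `log₂ = log ∘ log`. -/
noncomputable def log₂ (x : ℝ) : ℝ := Real.log (Real.log x)

/-- `λ(z) = Γ(z+1)⁻¹ ∏_p (1 + z/(p-1)) (1 - 1/p)^z`. -/
noncomputable def lambdaFn (z : ℝ) : ℝ :=
  (Real.Gamma (z + 1))⁻¹ *
    ∏' p : Nat.Primes, ((1 + z / (((p : ℕ) : ℝ) - 1)) * (1 - 1 / ((p : ℕ) : ℝ)) ^ z)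

/-- `δ_k(x) = λ(κ) (log₂ x)^{k-1} / ((log x) (k-1)!)`, with `κ = (k-1)/log₂ x`. -/
noncomputable def deltak (k : ℕ) (x : ℝ) : ℝ :=
  lambdaFn (((k : ℝ) - 1) / log₂ x) * (log₂ x) ^ (k - 1) /
    (Real.log x * (Nat.factorial (k - 1) : ℝ))


lemma zeta_G : ∃ G : ℂ → ℂ, ContinuousOn G {s | 1 ≤ s.re} ∧ ∀ s : ℂ, 1 < s.re →
    LSeries (fun n => (ArithmeticFunction.vonMangoldt n : ℂ)) s = G s + 1 / (s - 1) := by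
  refine ⟨ArithmeticFunction.vonMangoldt.LFunctionResidueClassAux (q := 1) 1,
    ArithmeticFunction.vonMangoldt.continuousOn_LFunctionResidueClassAux (q := 1) 1, fun s hs => ?_⟩
  have h := ArithmeticFunction.vonMangoldt.eqOn_LFunctionResidueClassAux (q := 1) (a := 1) isUnit_one hs
  rw [h]
  have : ArithmeticFunction.vonMangoldt.residueClass (1 : ZMod 1) = fun n => ArithmeticFunction.vonMangoldt n := by
    ext n
    simp [ArithmeticFunction.vonMangoldt.residueClass, Set.indicator_apply, Subsingleton.elim (n : ZMod 1) 1]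
  simp only [this]
  simp

noncomputable def fejK (w : ℝ) : ℝ := if w = 0 then 1 else 2 * (1 - Real.cos w) / w ^ 2

lemma fejK_nonneg (w : ℝ) : 0 ≤ fejK w := by
  unfold fejK
  split_ifs
  · norm_num
  · have := Real.cos_le_one w
    apply div_nonneg <;> nlinarith [sq_nonneg w]

lemma fejK_le (w : ℝ) : fejK w ≤ 5 * (1 + w ^ 2)⁻¹ := by
  unfold fejK
  split_ifs with h
  · simp [h]
  · have h1 := Real.one_sub_sq_div_two_le_cos (x := w)
    have h2 := Real.neg_one_le_cos w
    have : 0 < w ^ 2 := by positivity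
    rw [← div_eq_mul_inv, div_le_div_iff₀ this (by positivity)]
    nlinarith

lemma fejK_measurable : Measurable fejK := by
  unfold fejK
  refine Measurable.ite (measurableSet_singleton 0) measurable_const ?_
  fun_prop

lemma fejK_integrable : Integrable fejK := by
  refine (integrable_inv_one_add_sq.const_mul 5).mono' fejK_measurable.aestronglyMeasurable ?_
  filter_upwards with w
  rw [Real.norm_of_nonneg (fejK_nonneg w)]
  exact fejK_le w

lemma fejK_pos : 0 < ∫ w, fejK w := by
  rw [integral_pos_iff_support_of_nonneg fejK_nonneg fejK_integrable]
  have : Set.Ioo (0 : ℝ) 1 ⊆ Function.support fejK := by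
    intro w hw
    have h1 : Real.cos w < 1 := by
      have := Real.cos_lt_cos_of_nonneg_of_le_pi le_rfl (by linarith [Real.pi_gt_three, hw.2]) hw.1
      simpa using this
    have : 0 < fejK w := by
      unfold fejK
      rw [if_neg hw.1.ne']
      have := hw.1
      apply div_pos <;> nlinarith [sq_nonneg w]
    exact this.ne'
  refine lt_of_lt_of_le ?_ (measure_mono this)
  simp

open Complex in
lemma fejer_identity (w : ℝ) :
    ∫ t in (-1 : ℝ)..1, ((1 - |t| : ℝ) : ℂ) * cexp (I * t * w) = (fejK w : ℂ) := by
  have hint : ∀ a b : ℝ, IntervalIntegrable (fun t : ℝ => ((1 - |t| : ℝ) : ℂ) * cexp (I * t * w)) volume a b := by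
    intro a b
    apply Continuous.intervalIntegrable
    fun_prop
  rw [← intervalIntegral.integral_add_adjacent_intervals (hint (-1) 0) (hint 0 1)]
  have e1 : ∫ t in (-1 : ℝ)..0, ((1 - |t| : ℝ) : ℂ) * cexp (I * t * w) = ∫ t in (-1 : ℝ)..0, (1 + (t : ℂ)) * cexp (I * t * w) := by
    apply intervalIntegral.integral_congr
    intro t ht
    rw [Set.uIcc_of_le (by norm_num)] at ht
    simp [abs_of_nonpos ht.2]
  have e2 : ∫ t in (0 : ℝ)..1, ((1 - |t| : ℝ) : ℂ) * cexp (I * t * w) = ∫ t in (0 : ℝ)..1, (1 - (t : ℂ)) * cexp (I * t * w) := by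
    apply intervalIntegral.integral_congr
    intro t ht
    rw [Set.uIcc_of_le (by norm_num)] at ht
    simp [abs_of_nonneg ht.1]
  rw [e1, e2]
  by_cases h : w = 0
  · subst h
    have d1 : ∀ t : ℝ, HasDerivAt (fun t : ℝ => (t : ℂ) + (t : ℂ) ^ 2 / 2) (1 + (t : ℂ)) t := by
      intro t
      have := (hasDerivAt_id (t : ℂ)).add (((hasDerivAt_id (t : ℂ)).pow 2).div_const 2)
      have := this.comp_ofReal
      convert! this using 1
      simp
    have d2 : ∀ t : ℝ, HasDerivAt (fun t : ℝ => (t : ℂ) - (t : ℂ) ^ 2 / 2) (1 - (t : ℂ)) t := by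
      intro t
      have := (hasDerivAt_id (t : ℂ)).sub (((hasDerivAt_id (t : ℂ)).pow 2).div_const 2)
      have := this.comp_ofReal
      convert! this using 1
      simp
    simp only [ofReal_zero, mul_zero, Complex.exp_zero, mul_one]
    rw [intervalIntegral.integral_eq_sub_of_hasDerivAt (fun t _ => d1 t) (by apply Continuous.intervalIntegrable; fun_prop),
      intervalIntegral.integral_eq_sub_of_hasDerivAt (fun t _ => d2 t) (by apply Continuous.intervalIntegrable; fun_prop)]
    simp [fejK]
    norm_num
  · have hw : (w : ℂ) ≠ 0 := by exact_mod_cast h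
    have hE : ∀ t : ℝ, HasDerivAt (fun t : ℂ => cexp (I * t * w)) (cexp (I * t * w) * (I * w)) t := by
      intro t
      have : HasDerivAt (fun t : ℂ => I * t * w) (I * w) t := by
        simpa using ((hasDerivAt_id (t : ℂ)).const_mul I).mul_const (w : ℂ)
      exact this.cexp
    have d1 : ∀ t : ℝ, HasDerivAt (fun t : ℝ => (1 + (t : ℂ)) * cexp (I * t * w) / (I * w) - cexp (I * t * w) / (I * w) ^ 2)
        ((1 + (t : ℂ)) * cexp (I * t * w)) t := by
      intro t
      have := (((((hasDerivAt_id (t : ℂ)).const_add 1).mul (hE t)).div_const (I * w)).sub ((hE t).div_const ((I * w) ^ 2))).comp_ofReal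
      convert! this using 1
      simp only [id]
      field_simp
      ring
    have d2 : ∀ t : ℝ, HasDerivAt (fun t : ℝ => (1 - (t : ℂ)) * cexp (I * t * w) / (I * w) + cexp (I * t * w) / (I * w) ^ 2)
        ((1 - (t : ℂ)) * cexp (I * t * w)) t := by
      intro t
      have := (((((hasDerivAt_id (t : ℂ)).const_sub 1).mul (hE t)).div_const (I * w)).add ((hE t).div_const ((I * w) ^ 2))).comp_ofReal
      convert! this using 1
      simp only [id]
      field_simp
      ring
    rw [intervalIntegral.integral_eq_sub_of_hasDerivAt (fun t _ => d1 t) (by apply Continuous.intervalIntegrable; fun_prop),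
      intervalIntegral.integral_eq_sub_of_hasDerivAt (fun t _ => d2 t) (by apply Continuous.intervalIntegrable; fun_prop)]
    have hc : (fejK w : ℂ) = 2 * (1 - (cexp (w * I) + cexp (-w * I)) / 2) / w ^ 2 := by
      simp only [fejK, if_neg h]
      push_cast
      rw [Complex.cos]
    rw [hc]
    have a1 : I * ((1 : ℝ) : ℂ) * w = w * I := by push_cast; ring
    have a2 : I * ((-1 : ℝ) : ℂ) * w = - w * I := by push_cast; ring
    rw [a1, a2]
    simp only [ofReal_zero, mul_zero, zero_mul, Complex.exp_zero, mul_pow, I_sq]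
    push_cast
    field_simp
    ring_nf


open Complex in
lemma pole_transform (σ lam v : ℝ) (hσ : 1 < σ) :
    ∫ t in (-1 : ℝ)..1, ((1 - |t| : ℝ) : ℂ) * cexp (I * lam * t * v) * (1 / ((σ : ℂ) + I * lam * t - 1))
      = ((∫ u in Set.Ioi (0 : ℝ), Real.exp (-(σ - 1) * u) * fejK (lam * (v - u)) : ℝ) : ℂ) := by
  have h1 : ∀ t : ℝ, (1 / ((σ : ℂ) + I * lam * t - 1)) = ∫ u in Set.Ioi (0 : ℝ), cexp (-((σ : ℂ) + I * lam * t - 1) * u) := by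
    intro t
    have hre : (-((σ : ℂ) + I * lam * t - 1)).re < 0 := by simp; linarith
    rw [integral_exp_mul_complex_Ioi hre 0]
    rw [ofReal_zero, mul_zero, Complex.exp_zero, neg_div_neg_eq]
  simp_rw [h1, ← integral_const_mul]
  rw [intervalIntegral.integral_of_le (by norm_num), integral_integral_swap]
  · rw [← integral_complex_ofReal]
    apply integral_congr_ae
    filter_upwards with u
    rw [ofReal_mul, ← fejer_identity, intervalIntegral.integral_of_le (by norm_num), ← integral_const_mul]
    apply integral_congr_ae
    filter_upwards with t
    push_cast
    rw [mul_assoc, ← Complex.exp_add, mul_left_comm, ← Complex.exp_add]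
    congr 2
    ring
  · have : Integrable (Function.uncurry fun (t u : ℝ) => (1 : ℝ) * Real.exp (-(σ - 1) * u))
        ((volume.restrict (Set.Ioc (-1 : ℝ) 1)).prod (volume.restrict (Set.Ioi (0 : ℝ)))) := by
      apply Integrable.mul_prod (f := fun _ => (1 : ℝ)) (g := fun u : ℝ => Real.exp (-(σ - 1) * u))
      · simp
      · exact exp_neg_integrableOn_Ioi 0 (by linarith)
    refine this.mono' ?_ ?_
    · apply Continuous.aestronglyMeasurable
      unfold Function.uncurry
      fun_prop
    · rw [Measure.prod_restrict]
      refine (ae_restrict_iff' (measurableSet_Ioc.prod measurableSet_Ioi)).2 ?_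
      filter_upwards with z hz
      obtain ⟨t, u⟩ := z
      simp only [Set.mem_prod, Set.mem_Ioc, Set.mem_Ioi] at hz
      simp only [Function.uncurry, norm_mul, Complex.norm_exp]
      have e1 : (I * lam * t * v : ℂ).re = 0 := by simp
      have e2 : (-((σ : ℂ) + I * lam * t - 1) * u).re = -(σ - 1) * u := by simp
      rw [e1, e2, Real.exp_zero, mul_one]
      gcongr
      rw [norm_real, Real.norm_eq_abs, abs_le]
      have := abs_le.2 ⟨hz.1.1.le, hz.1.2⟩
      constructor <;> linarith [abs_nonneg t]

lemma pole_bound (σ lam v : ℝ) (hσ : 1 < σ) (hl : 0 < lam) :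
    ∫ u in Set.Ioi (0 : ℝ), Real.exp (-(σ - 1) * u) * fejK (lam * (v - u)) ≤ (∫ w, fejK w) / lam := by
  have hi : Integrable (fun u => fejK (lam * (v - u))) := by
    have := (fejK_integrable.comp_mul_left' hl.ne').comp_sub_left v
    exact this
  calc _ ≤ ∫ u in Set.Ioi (0 : ℝ), fejK (lam * (v - u)) := by
        apply integral_mono_of_nonneg
        · filter_upwards with u using mul_nonneg (Real.exp_pos _).le (fejK_nonneg _)
        · exact hi.integrableOn
        · refine (ae_restrict_iff' measurableSet_Ioi).2 ?_
          filter_upwards with u hu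
          have : Real.exp (-(σ - 1) * u) ≤ 1 := by
            rw [Real.exp_le_one_iff]
            have : 0 < u := hu
            nlinarith
          exact mul_le_of_le_one_left (fejK_nonneg _) this
    _ ≤ ∫ u, fejK (lam * (v - u)) := setIntegral_le_integral hi (by filter_upwards with u using fejK_nonneg _)
    _ = (∫ w, fejK w) / lam := by
        rw [integral_sub_left_eq_self (fun u => fejK (lam * u)) volume v, Measure.integral_comp_mul_left]
        rw [abs_of_pos (by positivity), smul_eq_mul]; ring

open Complex in
lemma sum_transform (σ lam v : ℝ) (hσ : 1 < σ) :
    HasSum (fun n : ℕ => ((ArithmeticFunction.vonMangoldt n / (n : ℝ) ^ σ * fejK (lam * (v - Real.log n)) : ℝ) : ℂ))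
    (∫ t in (-1 : ℝ)..1, ((1 - |t| : ℝ) : ℂ) * cexp (I * lam * t * v) *
      LSeries (fun n => (ArithmeticFunction.vonMangoldt n : ℂ)) ((σ : ℂ) + I * lam * t)) := by
  have hsum : LSeriesSummable (fun n => (ArithmeticFunction.vonMangoldt n : ℂ)) (σ : ℂ) :=
    ArithmeticFunction.LSeriesSummable_vonMangoldt (by simpa using hσ)
  have hterm : ∀ (n : ℕ) (t : ℝ), LSeries.term (fun n => (ArithmeticFunction.vonMangoldt n : ℂ)) ((σ : ℂ) + I * lam * t) n
      = ((ArithmeticFunction.vonMangoldt n / (n : ℝ) ^ σ : ℝ) : ℂ) * cexp (- (I * lam * t * Real.log n)) := by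
    intro n t
    by_cases hn : n = 0
    · simp [hn]
    · have hn' : (n : ℂ) ≠ 0 := by exact_mod_cast hn
      rw [LSeries.term_of_ne_zero hn, Complex.cpow_add _ _ hn', ofReal_div, ofReal_cpow n.cast_nonneg,
        Complex.exp_neg, Complex.cpow_def_of_ne_zero hn' (I * lam * t)]
      rw [ofReal_natCast, natCast_log, div_mul_eq_div_div, div_eq_mul_inv (_ / _)]
      congr 3
      ring
  set f : ℕ → C(ℝ, ℂ) := fun n => ⟨fun t => ((1 - |t| : ℝ) : ℂ) * cexp (I * lam * t * v) *
      (((ArithmeticFunction.vonMangoldt n / (n : ℝ) ^ σ : ℝ) : ℂ) * cexp (- (I * lam * t * Real.log n))), by fun_prop⟩ with hf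
  have key := intervalIntegral.hasSum_intervalIntegral_of_summable_norm (a := -1) (b := 1) (f := f) (by
    refine Summable.of_nonneg_of_le (fun _ => norm_nonneg _) (fun n => ?_) hsum.norm
    rw [ContinuousMap.norm_le _ (norm_nonneg _)]
    rintro ⟨t, ht⟩
    simp only [TopologicalSpace.Compacts.coe_mk, Set.uIcc_of_le (show (-1 : ℝ) ≤ 1 by norm_num)] at ht
    simp only [hf, ContinuousMap.restrict_apply, ContinuousMap.coe_mk]
    have h0 := hterm n 0
    simp only [ofReal_zero, mul_zero, add_zero, zero_mul, neg_zero, Complex.exp_zero, mul_one] at h0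
    rw [h0, norm_mul, norm_mul, norm_mul, Complex.norm_exp, Complex.norm_exp]
    have e1 : (I * lam * t * v : ℂ).re = 0 := by simp
    have e2 : (-(I * lam * t * Real.log n) : ℂ).re = 0 := by simp [← natCast_log]
    rw [e1, e2, Real.exp_zero, mul_one, mul_one]
    apply mul_le_of_le_one_left (norm_nonneg _)
    rw [norm_real, Real.norm_eq_abs, abs_le]
    have := abs_le.2 ht
    constructor <;> linarith [abs_nonneg t])
  convert! key using 1
  · ext n
    rw [ofReal_mul, ← fejer_identity, ← intervalIntegral.integral_const_mul]
    apply intervalIntegral.integral_congr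
    intro t _
    simp only [hf, ContinuousMap.coe_mk]
    have he : cexp (I * t * ((lam * (v - Real.log n) : ℝ) : ℂ)) = cexp (I * lam * t * v) * cexp (-(I * lam * t * (Real.log n : ℝ))) := by
      rw [← Complex.exp_add]
      congr 1
      push_cast
      ring
    rw [he]
    ring
  · apply intervalIntegral.integral_congr
    intro t _
    simp only [hf, ContinuousMap.coe_mk, LSeries]
    rw [tsum_mul_left]
    congr 1
    exact tsum_congr fun n => hterm n t

open Complex in
lemma finite_bound_sigma (G : ℂ → ℂ) (hG : ContinuousOn G {s | 1 ≤ s.re})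
    (hL : ∀ s : ℂ, 1 < s.re → LSeries (fun n => (ArithmeticFunction.vonMangoldt n : ℂ)) s = G s + 1 / (s - 1))
    (σ lam v : ℝ) (hσ : 1 < σ) (hl : 0 < lam) (F : Finset ℕ) :
    ∑ n ∈ F, ArithmeticFunction.vonMangoldt n / (n : ℝ) ^ σ * fejK (lam * (v - Real.log n)) ≤
      (∫ w, fejK w) / lam + ‖∫ t in (-1 : ℝ)..1, ((1 - |t| : ℝ) : ℂ) * cexp (I * lam * t * v) *
        G ((σ : ℂ) + I * lam * t)‖ := by
  have h := sum_transform σ lam v hσ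
  have e : (∫ t in (-1 : ℝ)..1, ((1 - |t| : ℝ) : ℂ) * cexp (I * lam * t * v) *
      LSeries (fun n => (ArithmeticFunction.vonMangoldt n : ℂ)) ((σ : ℂ) + I * lam * t)) =
      (∫ t in (-1 : ℝ)..1, ((1 - |t| : ℝ) : ℂ) * cexp (I * lam * t * v) * G ((σ : ℂ) + I * lam * t)) +
      ((∫ u in Set.Ioi (0 : ℝ), Real.exp (-(σ - 1) * u) * fejK (lam * (v - u)) : ℝ) : ℂ) := by
    rw [← pole_transform σ lam v hσ, ← intervalIntegral.integral_add]
    · apply intervalIntegral.integral_congr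
      intro t _
      simp only
      rw [hL _ (by simpa using hσ)]
      ring
    · apply Continuous.intervalIntegrable
      refine Continuous.mul (by fun_prop) ?_
      exact hG.comp_continuous (by fun_prop) (fun t => by simpa using hσ.le)
    · apply Continuous.intervalIntegrable
      refine Continuous.mul (by fun_prop) ?_
      refine Continuous.div (by fun_prop) (by fun_prop) (fun t h0 => ?_)
      have := congrArg Complex.re h0
      simp at this
      linarith
  rw [e] at h
  have hre := hasSum_re h
  simp only [ofReal_re, add_re] at hre
  have h2 : ∑ n ∈ F, ArithmeticFunction.vonMangoldt n / (n : ℝ) ^ σ * fejK (lam * (v - Real.log n)) ≤ _ :=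
    sum_le_hasSum F (fun n _ => mul_nonneg (div_nonneg ArithmeticFunction.vonMangoldt_nonneg (by positivity)) (fejK_nonneg _)) hre
  have h3 := pole_bound σ lam v hσ hl
  have h4 := Complex.re_le_norm (∫ t in (-1 : ℝ)..1, ((1 - |t| : ℝ) : ℂ) * cexp (I * lam * t * v) * G ((σ : ℂ) + I * lam * t))
  linarith

open Complex Filter Topology in
lemma finite_bound (G : ℂ → ℂ) (hG : ContinuousOn G {s | 1 ≤ s.re})
    (hL : ∀ s : ℂ, 1 < s.re → LSeries (fun n => (ArithmeticFunction.vonMangoldt n : ℂ)) s = G s + 1 / (s - 1))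
    (lam v : ℝ) (hl : 0 < lam) (F : Finset ℕ) :
    ∑ n ∈ F, ArithmeticFunction.vonMangoldt n / (n : ℝ) * fejK (lam * (v - Real.log n)) ≤
      (∫ w, fejK w) / lam + ‖∫ t in (-1 : ℝ)..1, ((1 - |t| : ℝ) : ℂ) * cexp (I * lam * t * v) *
        G ((1 : ℂ) + I * lam * t)‖ := by
  have hne : (𝓝[>] (1 : ℝ)).NeBot := inferInstance
  have hcont : Continuous (fun p : ℝ × ℝ => G ((max p.1 1 : ℝ) + I * lam * p.2)) := by
    refine hG.comp_continuous (by fun_prop) (fun t => by simp)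
  have hcont2 : Continuous (fun σ : ℝ => ∫ t in (-1 : ℝ)..1, ((1 - |t| : ℝ) : ℂ) * cexp (I * lam * t * v) * G ((max σ 1 : ℝ) + I * lam * t)) := by
    apply intervalIntegral.continuous_parametric_intervalIntegral_of_continuous'
    exact Continuous.mul (by fun_prop) hcont
  have hev : ∀ᶠ σ in 𝓝[>] (1 : ℝ), ∑ n ∈ F, ArithmeticFunction.vonMangoldt n / (n : ℝ) ^ σ * fejK (lam * (v - Real.log n)) ≤
      (∫ w, fejK w) / lam + ‖∫ t in (-1 : ℝ)..1, ((1 - |t| : ℝ) : ℂ) * cexp (I * lam * t * v) * G ((max σ 1 : ℝ) + I * lam * t)‖ := by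
    filter_upwards [self_mem_nhdsWithin] with σ hσ
    rw [max_eq_left (le_of_lt hσ)]
    exact finite_bound_sigma G hG hL σ lam v hσ hl F
  have l1 : Tendsto (fun σ : ℝ => ∑ n ∈ F, ArithmeticFunction.vonMangoldt n / (n : ℝ) ^ σ * fejK (lam * (v - Real.log n))) (𝓝[>] 1)
      (𝓝 (∑ n ∈ F, ArithmeticFunction.vonMangoldt n / (n : ℝ) * fejK (lam * (v - Real.log n)))) := by
    apply tendsto_nhdsWithin_of_tendsto_nhds
    apply tendsto_finsetSum
    intro n _
    by_cases hn : n = 0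
    · simp [hn]
    have hn' : (0 : ℝ) < n := by positivity
    apply Tendsto.mul_const
    have : ContinuousAt (fun σ : ℝ => ArithmeticFunction.vonMangoldt n / (n : ℝ) ^ σ) 1 := by
      refine ContinuousAt.div continuousAt_const ?_ (by positivity)
      exact (Real.continuous_const_rpow hn'.ne').continuousAt
    simpa [ContinuousAt] using this
  have l2 := ((hcont2.tendsto 1).norm.const_add ((∫ w, fejK w) / lam)).mono_left (nhdsWithin_le_nhds (s := Set.Ioi 1))
  have := le_of_tendsto_of_tendsto l1 l2 hev
  simpa using this

open Complex Filter Topology in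
lemma RL_bound (G : ℂ → ℂ) (hG : ContinuousOn G {s | 1 ≤ s.re}) (lam : ℝ) (hl : 0 < lam) :
    Tendsto (fun v : ℝ => ‖∫ t in (-1 : ℝ)..1, ((1 - |t| : ℝ) : ℂ) * cexp (I * lam * t * v) *
        G ((1 : ℂ) + I * lam * t)‖) atTop (𝓝 0) := by
  have h := Real.tendsto_integral_exp_smul_cocompact (fun t => (Set.Ioc (-1 : ℝ) 1).indicator (fun t => ((1 - |t| : ℝ) : ℂ) * G ((1 : ℂ) + I * lam * t)) t)
  have ht : Tendsto (fun v : ℝ => -(lam * v / (2 * Real.pi))) atTop (cocompact ℝ) := by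
    have : Tendsto (fun v : ℝ => -(lam * v / (2 * Real.pi))) atTop atBot := by
      apply tendsto_neg_atTop_atBot.comp
      exact (tendsto_id.const_mul_atTop hl).atTop_div_const (by positivity)
    exact this.mono_right atBot_le_cocompact
  have h2 := (h.comp ht).norm
  rw [norm_zero] at h2
  refine h2.congr (fun v => ?_)
  simp only [Function.comp]
  congr 1
  rw [intervalIntegral.integral_of_le (by norm_num), ← integral_indicator measurableSet_Ioc]
  congr 1
  ext t
  by_cases htm : t ∈ Set.Ioc (-1 : ℝ) 1
  · simp only [Set.indicator_of_mem htm]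
    rw [Circle.smul_def, Real.fourierChar_apply, smul_eq_mul]
    have : (Real.pi : ℂ) ≠ 0 := by exact_mod_cast Real.pi_ne_zero
    have he : cexp (((2 * Real.pi * -(t * -(lam * v / (2 * Real.pi))) : ℝ) : ℂ) * I) = cexp (I * lam * t * v) := by
      congr 1
      push_cast
      field_simp
    rw [he]
    ring
  · simp [Set.indicator_of_notMem htm]


lemma fejK_shift_ii (lam u a b : ℝ) (hl : 0 < lam) :
    IntervalIntegrable (fun t => fejK (lam * (t - u))) volume a b := by
  have : Integrable (fun t => fejK (lam * (t - u))) :=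
    (fejK_integrable.comp_mul_left' hl.ne').comp_sub_right u
  exact this.intervalIntegrable

lemma fejK_lower (lam u δ a b : ℝ) (hl : 0 < lam) (hδ : 0 < δ) (ha : a ≤ u - δ) (hb : u + δ ≤ b) :
    Real.exp (u - δ) * (lam⁻¹ * ∫ w in (-(lam * δ))..(lam * δ), fejK w) ≤
      ∫ t in a..b, Real.exp t * fejK (lam * (t - u)) := by
  have hii : ∀ a b : ℝ, IntervalIntegrable (fun t => Real.exp t * fejK (lam * (t - u))) volume a b := fun a b =>
    (fejK_shift_ii lam u a b hl).continuousOn_mul Real.continuous_exp.continuousOn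
  calc _ = ∫ t in (u - δ)..(u + δ), Real.exp (u - δ) * fejK (lam * (t - u)) := by
        rw [intervalIntegral.integral_const_mul]
        congr 1
        have : ∀ t, lam * (t - u) = lam * t - lam * u := fun t => by ring
        simp_rw [this]
        rw [intervalIntegral.integral_comp_mul_sub _ hl.ne', smul_eq_mul]
        congr 2 <;> ring
    _ ≤ ∫ t in (u - δ)..(u + δ), Real.exp t * fejK (lam * (t - u)) := by
        apply intervalIntegral.integral_mono_on (by linarith) ((fejK_shift_ii lam u _ _ hl).const_mul _) (hii _ _)
        intro t ht
        exact mul_le_mul_of_nonneg_right (Real.exp_le_exp.2 ht.1) (fejK_nonneg _)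
    _ ≤ _ := by
        apply intervalIntegral.integral_mono_interval ha (by linarith) hb _ (hii _ _)
        filter_upwards with t using mul_nonneg (Real.exp_pos _).le (fejK_nonneg _)

open Filter Topology in
lemma psi_dyadic (ε : ℝ) (hε : 0 < ε) : ∃ y₀ : ℝ, 1 ≤ y₀ ∧ ∀ y : ℝ, y₀ ≤ y →
    ∑ n ∈ Finset.Ioc ⌊y⌋₊ ⌊2 * y⌋₊, ArithmeticFunction.vonMangoldt n ≤ (1 + ε) * y := by
  obtain ⟨G, hG, hL⟩ := zeta_G
  set c := ∫ w, fejK w with hc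
  have hcpos : 0 < c := fejK_pos
  obtain ⟨δ, hδ, hδε⟩ : ∃ δ : ℝ, 0 < δ ∧ Real.exp δ * (1 + δ) ^ 2 * (2 * Real.exp δ - Real.exp (-δ)) < 1 + ε := by
    have : ContinuousAt (fun δ : ℝ => Real.exp δ * (1 + δ) ^ 2 * (2 * Real.exp δ - Real.exp (-δ))) 0 := by fun_prop
    have h1 : ∀ᶠ δ in 𝓝 (0 : ℝ), Real.exp δ * (1 + δ) ^ 2 * (2 * Real.exp δ - Real.exp (-δ)) < 1 + ε := by
      apply this.eventually_lt continuousAt_const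
      norm_num
      exact hε
    have h2 := (h1.filter_mono (nhdsWithin_le_nhds (s := Set.Ioi 0))).and (self_mem_nhdsWithin (s := Set.Ioi (0 : ℝ)))
    obtain ⟨δ, h3, h4⟩ := h2.exists
    exact ⟨δ, h4, h3⟩
  obtain ⟨R, hR, hRc⟩ : ∃ R : ℝ, 0 < R ∧ c / (1 + δ) < ∫ w in (-R)..R, fejK w := by
    have h := intervalIntegral_tendsto_integral fejK_integrable tendsto_neg_atTop_atBot tendsto_id (ι := ℝ) (l := atTop)
    have h1 : c / (1 + δ) < c := div_lt_self hcpos (by linarith)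
    have h2 := (h.eventually (lt_mem_nhds h1)).and (eventually_gt_atTop 0)
    obtain ⟨R, h3, h4⟩ := h2.exists
    exact ⟨R, h4, h3⟩
  set lam := R / δ with hlam
  have hl : 0 < lam := by positivity
  have hlR : lam * δ = R := by rw [hlam]; field_simp
  obtain ⟨V, hV⟩ : ∃ V : ℝ, ∀ v ≥ V, ‖∫ t in (-1 : ℝ)..1, ((1 - |t| : ℝ) : ℂ) * Complex.exp (Complex.I * lam * t * v) *
        G ((1 : ℂ) + Complex.I * lam * t)‖ < δ * c / lam :=
    eventually_atTop.1 ((RL_bound G hG lam hl).eventually (gt_mem_nhds (by positivity)))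
  refine ⟨max 1 (Real.exp (V + δ)), le_max_left _ _, fun y hy => ?_⟩
  have hy1 : 1 ≤ y := (le_max_left _ _).trans hy
  have hypos : 0 < y := by linarith
  set v := Real.log y with hv
  have hvV : V + δ ≤ v := (Real.le_log_iff_exp_le hypos).2 ((le_max_right _ _).trans hy)
  set F := Finset.Ioc ⌊y⌋₊ ⌊2 * y⌋₊ with hF
  have hmem : ∀ n ∈ F, y < n ∧ (n : ℝ) ≤ 2 * y := by
    intro n hn
    rw [hF, Finset.mem_Ioc] at hn
    exact ⟨(Nat.floor_lt hypos.le).1 hn.1, (Nat.le_floor_iff (by linarith)).1 hn.2⟩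
  have hii : ∀ u a b : ℝ, IntervalIntegrable (fun t => Real.exp t * fejK (lam * (t - u))) volume a b := fun u a b =>
    (fejK_shift_ii lam u a b hl).continuousOn_mul Real.continuous_exp.continuousOn
  have hlog2 := Real.log_pos one_lt_two
  -- lower bound
  have low : ∑ n ∈ F, ArithmeticFunction.vonMangoldt n * (Real.exp (-δ) * (lam⁻¹ * (c / (1 + δ)))) ≤
      ∑ n ∈ F, ArithmeticFunction.vonMangoldt n / n * ∫ t in (v - δ)..(v + Real.log 2 + δ), Real.exp t * fejK (lam * (t - Real.log n)) := by
    apply Finset.sum_le_sum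
    intro n hn
    obtain ⟨h1, h2⟩ := hmem n hn
    have hn0 : (0 : ℝ) < n := by linarith
    have := fejK_lower lam (Real.log n) δ (v - δ) (v + Real.log 2 + δ) hl hδ
      (by have := Real.log_le_log hypos h1.le; linarith)
      (by have := Real.log_le_log hn0 h2
          rw [Real.log_mul (by norm_num) hypos.ne'] at this; linarith)
    rw [hlR] at this
    rw [div_mul_eq_mul_div, mul_div_assoc]
    apply mul_le_mul_of_nonneg_left _ ArithmeticFunction.vonMangoldt_nonneg
    rw [le_div_iff₀ hn0]
    refine le_trans ?_ this
    rw [sub_eq_add_neg, Real.exp_add, Real.exp_log hn0]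
    calc _ = n * Real.exp (-δ) * (lam⁻¹ * (c / (1 + δ))) := by ring
      _ ≤ _ := by gcongr
  have swap : ∑ n ∈ F, ArithmeticFunction.vonMangoldt n / n * ∫ t in (v - δ)..(v + Real.log 2 + δ), Real.exp t * fejK (lam * (t - Real.log n))
      = ∫ t in (v - δ)..(v + Real.log 2 + δ), ∑ n ∈ F, ArithmeticFunction.vonMangoldt n / n * (Real.exp t * fejK (lam * (t - Real.log n))) := by
    rw [intervalIntegral.integral_finsetSum]
    · simp_rw [intervalIntegral.integral_const_mul]
    · intro n _
      exact (hii _ _ _).const_mul _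
  have up : ∫ t in (v - δ)..(v + Real.log 2 + δ), ∑ n ∈ F, ArithmeticFunction.vonMangoldt n / n * (Real.exp t * fejK (lam * (t - Real.log n)))
      ≤ ∫ t in (v - δ)..(v + Real.log 2 + δ), Real.exp t * (c / lam * (1 + δ)) := by
    apply intervalIntegral.integral_mono_on (by linarith)
    · have hs := IntervalIntegrable.sum F (μ := volume) (a := v - δ) (b := v + Real.log 2 + δ)
        (f := fun n u => ArithmeticFunction.vonMangoldt n / (n : ℝ) * (Real.exp u * fejK (lam * (u - Real.log n))))
        (fun n _ => (hii _ _ _).const_mul _)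
      convert! hs using 1
      ext u
      simp
    · apply Continuous.intervalIntegrable; fun_prop
    intro t ht
    have h1 := finite_bound G hG hL lam t hl F
    have h2 := hV t (by linarith [ht.1])
    have h3 : ∑ n ∈ F, ArithmeticFunction.vonMangoldt n / n * (Real.exp t * fejK (lam * (t - Real.log n))) =
      Real.exp t * ∑ n ∈ F, ArithmeticFunction.vonMangoldt n / n * fejK (lam * (t - Real.log n)) := by
      rw [Finset.mul_sum]; exact Finset.sum_congr rfl fun n _ => by ring
    rw [h3]
    apply mul_le_mul_of_nonneg_left _ (Real.exp_pos _).le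
    have : c / lam * (1 + δ) = c / lam + δ * c / lam := by ring
    rw [this]
    linarith
  have ev : ∫ t in (v - δ)..(v + Real.log 2 + δ), Real.exp t * (c / lam * (1 + δ)) = (2 * Real.exp δ - Real.exp (-δ)) * y * (c / lam * (1 + δ)) := by
    rw [intervalIntegral.integral_mul_const, integral_exp, sub_eq_add_neg v, Real.exp_add, Real.exp_add, Real.exp_add,
      Real.exp_log hypos, Real.exp_log two_pos]
    ring
  rw [swap] at low
  have tot := low.trans (up.trans_eq ev)
  rw [← Finset.sum_mul] at tot
  set S := ∑ n ∈ F, ArithmeticFunction.vonMangoldt n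
  have hS : S = (S * (Real.exp (-δ) * (lam⁻¹ * (c / (1 + δ))))) * (Real.exp δ * (1 + δ) * lam / c) := by
    have : Real.exp (-δ) * Real.exp δ = 1 := by rw [← Real.exp_add]; simp
    field_simp
    linear_combination (-S) * this
  rw [hS]
  calc _ ≤ (2 * Real.exp δ - Real.exp (-δ)) * y * (c / lam * (1 + δ)) * (Real.exp δ * (1 + δ) * lam / c) := by
        gcongr
    _ = Real.exp δ * (1 + δ) ^ 2 * (2 * Real.exp δ - Real.exp (-δ)) * y := by
        field_simp
    _ ≤ _ := by gcongr

/-- log-weight on prime powers -/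
noncomputable def ppw (n : ℕ) : ℝ := if IsPrimePow n then Real.log n else 0

lemma ppw_nonneg (n : ℕ) : 0 ≤ ppw n := by
  unfold ppw
  split_ifs
  · exact Real.log_natCast_nonneg n
  · exact le_rfl

lemma ppw_le (n : ℕ) (N : ℝ) (hn : (n : ℝ) ≤ N) (hN : 1 ≤ N) : ppw n ≤ ArithmeticFunction.vonMangoldt n +
    (Real.log N / Real.log 2) * (if n.Prime then 0 else ArithmeticFunction.vonMangoldt n) := by
  unfold ppw
  have hl2 := Real.log_pos one_lt_two
  by_cases hpp : IsPrimePow n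
  · rw [if_pos hpp]
    by_cases hp : n.Prime
    · simp [hp, ArithmeticFunction.vonMangoldt_apply_prime]
    · rw [if_neg hp]
      have h1 : Real.log 2 ≤ ArithmeticFunction.vonMangoldt n := by
        rw [ArithmeticFunction.vonMangoldt_apply, if_pos hpp]
        apply Real.log_le_log (by norm_num)
        exact_mod_cast (Nat.minFac_prime hpp.ne_one).two_le
      have h2 : Real.log n ≤ Real.log N := Real.log_le_log (by exact_mod_cast hpp.pos) hn
      have h3 : 0 ≤ Real.log N := Real.log_nonneg hN
      have h4 : Real.log N / Real.log 2 * Real.log 2 ≤ Real.log N / Real.log 2 * ArithmeticFunction.vonMangoldt n := by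
        gcongr
      rw [div_mul_cancel₀ _ hl2.ne'] at h4
      linarith
  · rw [if_neg hpp]
    have h3 : 0 ≤ Real.log N := Real.log_nonneg hN
    have := ArithmeticFunction.vonMangoldt_nonneg (n := n)
    split_ifs <;> positivity

open Filter Topology in
lemma ppw_dyadic (ε : ℝ) (hε : 0 < ε) : ∃ y₀ : ℝ, 1 ≤ y₀ ∧ ∀ y : ℝ, y₀ ≤ y →
    ∑ n ∈ Finset.Ioc ⌊y⌋₊ ⌊2 * y⌋₊, ppw n ≤ (1 + ε) * y := by
  obtain ⟨y₀, h1, h2⟩ := psi_dyadic (ε / 2) (by linarith)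
  have hl2 := Real.log_pos one_lt_two
  have hlim : ∀ᶠ y : ℝ in atTop, Real.log (2 * y) / Real.log 2 * (2 * √(2 * y) * Real.log (2 * y)) ≤ ε / 2 * y := by
    have h := (isLittleO_log_rpow_atTop (r := 1 / 4) (by norm_num)).def (c := √(ε * Real.log 2 / 8)) (by positivity)
    have h' := (tendsto_id.const_mul_atTop (two_pos (α := ℝ))).eventually h
    filter_upwards [h', eventually_ge_atTop 1] with y hy hy1
    simp only [id] at hy
    have hz : 0 < 2 * y := by linarith
    rw [Real.norm_of_nonneg (Real.log_nonneg (by linarith)), Real.norm_of_nonneg (by positivity)] at hy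
    have hsq : Real.log (2 * y) ^ 2 ≤ (ε * Real.log 2 / 8) * √(2 * y) := by
      calc Real.log (2 * y) ^ 2 ≤ (√(ε * Real.log 2 / 8) * (2 * y) ^ (1 / 4 : ℝ)) ^ 2 := by
            apply pow_le_pow_left₀ (Real.log_nonneg (by linarith)) hy
        _ = _ := by
            rw [mul_pow, Real.sq_sqrt (by positivity), Real.sqrt_eq_rpow, ← Real.rpow_natCast, ← Real.rpow_mul hz.le]
            norm_num
    calc _ = (2 * √(2 * y) / Real.log 2) * Real.log (2 * y) ^ 2 := by ring
      _ ≤ (2 * √(2 * y) / Real.log 2) * ((ε * Real.log 2 / 8) * √(2 * y)) := by gcongr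
      _ = (ε / 4) * (√(2 * y) * √(2 * y)) := by field_simp; ring
      _ = _ := by rw [Real.mul_self_sqrt hz.le]; ring
  obtain ⟨Y, hY⟩ := eventually_atTop.1 hlim
  refine ⟨max y₀ Y, h1.trans (le_max_left _ _), fun y hy => ?_⟩
  have hy0 := (le_max_left _ _).trans hy
  have hy1 : 1 ≤ y := h1.trans hy0
  have a := h2 y hy0
  have b := hY y ((le_max_right _ _).trans hy)
  have hlog : 0 ≤ Real.log (2 * y) := Real.log_nonneg (by linarith)
  have step : ∑ n ∈ Finset.Ioc ⌊y⌋₊ ⌊2 * y⌋₊, ppw n ≤ ∑ n ∈ Finset.Ioc ⌊y⌋₊ ⌊2 * y⌋₊, (ArithmeticFunction.vonMangoldt n +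
    (Real.log (2 * y) / Real.log 2) * (if n.Prime then 0 else ArithmeticFunction.vonMangoldt n)) := by
    apply Finset.sum_le_sum
    intro n hn
    rw [Finset.mem_Ioc] at hn
    exact ppw_le n _ ((Nat.le_floor_iff (by linarith)).1 hn.2) (by linarith)
  rw [Finset.sum_add_distrib, ← Finset.mul_sum] at step
  have c1 : ∑ n ∈ Finset.Ioc ⌊y⌋₊ ⌊2 * y⌋₊, (if n.Prime then 0 else ArithmeticFunction.vonMangoldt n) ≤ 2 * √(2 * y) * Real.log (2 * y) := by
    refine le_trans ?_ (Chebyshev.psi_sub_theta_le (x := 2 * y) (by linarith))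
    rw [Chebyshev.psi_sub_theta_eq_sum_not_prime, Finset.sum_filter]
    simp_rw [ite_not]
    apply Finset.sum_le_sum_of_subset_of_nonneg
    · exact Finset.Ioc_subset_Ioc_left (Nat.zero_le _)
    · intro n _ _
      split_ifs
      · exact le_rfl
      · exact ArithmeticFunction.vonMangoldt_nonneg
  have c2 : Real.log (2 * y) / Real.log 2 * ∑ n ∈ Finset.Ioc ⌊y⌋₊ ⌊2 * y⌋₊, (if n.Prime then 0 else ArithmeticFunction.vonMangoldt n) ≤ Real.log (2 * y) / Real.log 2 * (2 * √(2 * y) * Real.log (2 * y)) := by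
    gcongr
  linarith

lemma ppw_cheb : ∃ C : ℝ, 0 ≤ C ∧ ∀ y : ℝ, 0 ≤ y →
    ∑ n ∈ Finset.Ioc ⌊y⌋₊ ⌊2 * y⌋₊, ppw n ≤ C * y := by
  obtain ⟨y₀, h1, h2⟩ := ppw_dyadic 1 one_pos
  set M := ∑ n ∈ Finset.Ioc 0 ⌊2 * y₀⌋₊, ppw n with hM
  have hM0 : 0 ≤ M := Finset.sum_nonneg fun n _ => ppw_nonneg n
  refine ⟨2 + 2 * M, by positivity, fun y hy => ?_⟩
  by_cases hyy : y₀ ≤ y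
  · have := h2 y hyy
    nlinarith
  · by_cases hh : y < 1 / 2
    · have : ⌊2 * y⌋₊ = 0 := Nat.floor_eq_zero.2 (by linarith)
      rw [this]
      simp
      positivity
    · have : ∑ n ∈ Finset.Ioc ⌊y⌋₊ ⌊2 * y⌋₊, ppw n ≤ M := by
        apply Finset.sum_le_sum_of_subset_of_nonneg
        · apply Finset.Ioc_subset_Ioc (Nat.zero_le _)
          apply Nat.floor_le_floor
          linarith
        · intro n _ _; exact ppw_nonneg n
      nlinarith


lemma sum_log_eq (N : ℕ) : ∑ n ∈ Finset.Ioc 0 N, Real.log n = Real.log (N.factorial) := by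
  induction N with
  | zero => simp
  | succ N ih =>
    rw [Finset.sum_Ioc_succ_top (Nat.zero_le _), ih, Nat.factorial_succ, Nat.cast_mul,
      Real.log_mul (by positivity) (by positivity), add_comm]

lemma mertens_one : ∃ C : ℝ, 0 ≤ C ∧ ∀ t : ℝ, 1 ≤ t →
    |∑ n ∈ Finset.Icc 0 ⌊t⌋₊, ArithmeticFunction.vonMangoldt n / (n : ℝ) - Real.log t| ≤ C := by
  refine ⟨Real.log 4 + 5, by have := Real.log_nonneg (show (1 : ℝ) ≤ 4 by norm_num); linarith, fun t ht => ?_⟩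
  have hl4 := Real.log_nonneg (show (1 : ℝ) ≤ 4 by norm_num)
  set N := ⌊t⌋₊ with hN
  have hN1 : 1 ≤ N := Nat.one_le_floor_iff _ |>.2 ht
  have hNpos : (0 : ℝ) < N := by exact_mod_cast hN1
  have hNt : (N : ℝ) ≤ t := Nat.floor_le (by linarith)
  have htN : t ≤ 2 * N := by
    have := (Nat.lt_floor_add_one t).le
    have : (1 : ℝ) ≤ N := by exact_mod_cast hN1
    linarith
  have l1 : Real.log N ≤ Real.log t := Real.log_le_log hNpos hNt
  have l2 : Real.log t ≤ Real.log N + 1 := by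
    have := Real.log_le_log (by linarith) htN
    rw [Real.log_mul two_ne_zero hNpos.ne'] at this
    have := Real.log_two_lt_d9
    linarith
  have hR : ∑ n ∈ Finset.Icc 0 N, ArithmeticFunction.vonMangoldt n / (n : ℝ) = ∑ n ∈ Finset.Ioc 0 N, ArithmeticFunction.vonMangoldt n / (n : ℝ) := by
    rw [← Finset.add_sum_Ioc_eq_sum_Icc (Nat.zero_le _)]; simp
  rw [hR]
  set R := ∑ n ∈ Finset.Ioc 0 N, ArithmeticFunction.vonMangoldt n / (n : ℝ)
  have key := ArithmeticFunction.sum_Ioc_mul_zeta_eq_sum ArithmeticFunction.vonMangoldt N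
  rw [ArithmeticFunction.vonMangoldt_mul_zeta] at key
  simp only [ArithmeticFunction.log_apply] at key
  rw [sum_log_eq] at key
  have hNR : (N : ℝ) * R = ∑ n ∈ Finset.Ioc 0 N, ArithmeticFunction.vonMangoldt n * ((N : ℝ) / n) := by
    rw [Finset.mul_sum]
    exact Finset.sum_congr rfl fun n _ => by ring
  have up : Real.log N.factorial ≤ N * R := by
    rw [key, hNR]
    apply Finset.sum_le_sum
    intro n _
    exact mul_le_mul_of_nonneg_left Nat.cast_div_le ArithmeticFunction.vonMangoldt_nonneg
  have lo : N * R ≤ Real.log N.factorial + (Real.log 4 + 4) * N := by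
    have h1 := Chebyshev.psi_le_const_mul_self (x := N) hNpos.le
    unfold Chebyshev.psi at h1
    rw [Nat.floor_natCast] at h1
    rw [key, hNR]
    refine le_trans ?_ (add_le_add_right h1 _)
    rw [← Finset.sum_add_distrib]
    apply Finset.sum_le_sum
    intro n hn
    have hn0 : 0 < n := (Finset.mem_Ioc.1 hn).1
    have : (N : ℝ) / n ≤ ((N / n : ℕ) : ℝ) + 1 := by
      rw [div_le_iff₀ (by exact_mod_cast hn0)]
      have := Nat.lt_div_mul_add (a := N) hn0
      have h2 : N ≤ (N / n + 1) * n := by rw [add_mul, one_mul]; exact this.le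
      exact_mod_cast h2
    have h3 := mul_le_mul_of_nonneg_left this (ArithmeticFunction.vonMangoldt_nonneg (n := n))
    linarith
  have f1 : N * Real.log N - N ≤ Real.log N.factorial := by
    have h := Real.pow_div_factorial_le_exp (N : ℝ) hNpos.le N
    have hf : (0 : ℝ) < N.factorial := by positivity
    have := Real.log_le_log (by positivity) h
    rw [Real.log_exp, Real.log_div (by positivity) (by positivity), Real.log_pow] at this
    linarith
  have f2 : Real.log N.factorial ≤ N * Real.log N := by
    rw [← Real.log_pow]
    apply Real.log_le_log (by positivity)
    exact_mod_cast Nat.factorial_le_pow N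
  have g1 : Real.log N - 1 ≤ R := by
    have : N * (Real.log N - 1) ≤ N * R := by linarith
    exact le_of_mul_le_mul_left this hNpos
  have g2 : R ≤ Real.log N + (Real.log 4 + 4) := by
    have : N * R ≤ N * (Real.log N + (Real.log 4 + 4)) := by linarith
    exact le_of_mul_le_mul_left this hNpos
  rw [abs_le]
  constructor <;> linarith

lemma mertens_two : ∃ C : ℝ, 0 ≤ C ∧ ∀ y z : ℝ, 2 ≤ y → y ≤ z →
    ∑ n ∈ Finset.Ioc ⌊y⌋₊ ⌊z⌋₊, ArithmeticFunction.vonMangoldt n / (n : ℝ) / Real.log n ≤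
      Real.log (Real.log z) - Real.log (Real.log y) + C := by
  obtain ⟨C, hC0, hC⟩ := mertens_one
  have hl2 := Real.log_pos one_lt_two
  refine ⟨3 * (C / Real.log 2), by positivity, fun y z hy hyz => ?_⟩
  have hlog : ∀ t, y ≤ t → 0 < Real.log t := fun t ht => Real.log_pos (by linarith)
  have hlog2 : ∀ t, y ≤ t → Real.log 2 ≤ Real.log t := fun t ht => Real.log_le_log (by norm_num) (by linarith)
  set f : ℝ → ℝ := fun t => (Real.log t)⁻¹ with hf
  have hd : ∀ t ∈ Set.Icc y z, HasDerivAt f (-(t⁻¹) / (Real.log t) ^ 2) t := by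
    intro t ht
    exact (Real.hasDerivAt_log (by linarith [ht.1])).fun_inv (hlog t ht.1).ne'
  have hcont : ContinuousOn (fun t : ℝ => -(t⁻¹) / (Real.log t) ^ 2) (Set.Icc y z) := by
    apply ContinuousOn.div
    · exact (continuousOn_inv₀.mono (fun t ht => by simp; linarith [ht.1])).neg
    · exact (Real.continuousOn_log.mono (fun t ht => by simp; linarith [ht.1])).pow 2
    · intro t ht; have := hlog t ht.1; positivity
  have hderiv : ∀ t ∈ Set.Icc y z, deriv f t = -(t⁻¹) / (Real.log t) ^ 2 := fun t ht => (hd t ht).deriv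
  have hint : IntegrableOn (deriv f) (Set.Icc y z) := by
    refine (hcont.integrableOn_Icc).congr_fun (fun t ht => (hderiv t ht).symm) measurableSet_Icc
  set c : ℕ → ℝ := fun n => ArithmeticFunction.vonMangoldt n / (n : ℝ) with hcdef
  have abel := sum_mul_eq_sub_sub_integral_mul c (f := f) (by linarith : (0 : ℝ) ≤ y) hyz (fun t ht => (hd t ht).differentiableAt) hint
  have e1 : ∑ n ∈ Finset.Ioc ⌊y⌋₊ ⌊z⌋₊, ArithmeticFunction.vonMangoldt n / (n : ℝ) / Real.log n = ∑ k ∈ Finset.Ioc ⌊y⌋₊ ⌊z⌋₊, f k * c k :=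
    Finset.sum_congr rfl fun n _ => by simp only [hf, hcdef]; ring
  rw [e1, abel]
  have hRz := abs_le.1 (hC z (by linarith))
  have hRy := abs_le.1 (hC y (by linarith))
  have b1 : f z * ∑ k ∈ Finset.Icc 0 ⌊z⌋₊, c k ≤ 1 + C / Real.log 2 := by
    have h1 : f z * ∑ k ∈ Finset.Icc 0 ⌊z⌋₊, c k ≤ f z * (Real.log z + C) :=
      mul_le_mul_of_nonneg_left (by simp only [hcdef]; linarith) (inv_nonneg.2 (hlog z hyz).le)
    have h2 : f z * (Real.log z + C) = 1 + C / Real.log z := by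
      simp only [hf]; have := (hlog z hyz).ne'; field_simp
    have h3 : C / Real.log z ≤ C / Real.log 2 := by
      have := hlog2 z hyz
      gcongr
    linarith
  have b2 : 1 - C / Real.log 2 ≤ f y * ∑ k ∈ Finset.Icc 0 ⌊y⌋₊, c k := by
    have h1 : f y * (Real.log y - C) ≤ f y * ∑ k ∈ Finset.Icc 0 ⌊y⌋₊, c k :=
      mul_le_mul_of_nonneg_left (by simp only [hcdef]; linarith) (inv_nonneg.2 (hlog y le_rfl).le)
    have h2 : f y * (Real.log y - C) = 1 - C / Real.log y := by
      simp only [hf]; have := (hlog y le_rfl).ne'; field_simp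
    have h3 : C / Real.log y ≤ C / Real.log 2 := by
      have := hlog2 y le_rfl
      gcongr
    linarith
  have b3 : - ∫ t in Set.Ioc y z, deriv f t * ∑ k ∈ Finset.Icc 0 ⌊t⌋₊, c k ≤
      ∫ t in Set.Ioc y z, (t⁻¹ / Real.log t + C * (t⁻¹ / Real.log t ^ 2)) := by
    rw [← integral_neg]
    apply setIntegral_mono_on
    · have := integrableOn_mul_sum_Icc (m := 0) c (by linarith : (0 : ℝ) ≤ y) hint
      exact (this.mono_set Set.Ioc_subset_Icc_self).neg
    · apply IntegrableOn.mono_set _ Set.Ioc_subset_Icc_self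
      apply ContinuousOn.integrableOn_Icc
      have hci : ContinuousOn (fun t : ℝ => t⁻¹) (Set.Icc y z) := continuousOn_inv₀.mono (fun t ht => by simp; linarith [ht.1])
      have hcl : ContinuousOn Real.log (Set.Icc y z) := Real.continuousOn_log.mono (fun t ht => by simp; linarith [ht.1])
      exact (hci.div hcl (fun t ht => (hlog t ht.1).ne')).add (continuousOn_const.mul (hci.div (hcl.pow 2) (fun t ht => by have := hlog t ht.1; positivity)))
    · exact measurableSet_Ioc
    · intro t ht
      rw [hderiv t (Set.Ioc_subset_Icc_self ht)]
      have htp : 0 < t := by linarith [ht.1]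
      have hlt := hlog t ht.1.le
      have hRt := abs_le.1 (hC t (by linarith [ht.1]))
      have h1 : t⁻¹ / Real.log t ^ 2 * ∑ k ∈ Finset.Icc 0 ⌊t⌋₊, c k ≤ t⁻¹ / Real.log t ^ 2 * (Real.log t + C) :=
        mul_le_mul_of_nonneg_left (by simp only [hcdef]; linarith) (by positivity)
      have h2 : t⁻¹ / Real.log t ^ 2 * (Real.log t + C) = t⁻¹ / Real.log t + C * (t⁻¹ / Real.log t ^ 2) := by
        field_simp
      have h3 : -(-t⁻¹ / Real.log t ^ 2 * ∑ k ∈ Finset.Icc 0 ⌊t⌋₊, c k) = t⁻¹ / Real.log t ^ 2 * ∑ k ∈ Finset.Icc 0 ⌊t⌋₊, c k := by ring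
      rw [h3]
      linarith
  have b4 : ∫ t in Set.Ioc y z, (t⁻¹ / Real.log t + C * (t⁻¹ / Real.log t ^ 2)) =
      (Real.log (Real.log z) + C * -(f z)) - (Real.log (Real.log y) + C * -(f y)) := by
    rw [← intervalIntegral.integral_of_le hyz]
    apply intervalIntegral.integral_eq_sub_of_hasDerivAt
    · intro t ht
      rw [Set.uIcc_of_le hyz] at ht
      have htp : 0 < t := by linarith [ht.1]
      have h1 := (Real.hasDerivAt_log htp.ne').log (hlog t ht.1).ne'
      have h2 := ((hd t ht).neg).const_mul C
      convert! h1.add h2 using 1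
      ring
    · apply ContinuousOn.intervalIntegrable
      rw [Set.uIcc_of_le hyz]
      have hci : ContinuousOn (fun t : ℝ => t⁻¹) (Set.Icc y z) := continuousOn_inv₀.mono (fun t ht => by simp; linarith [ht.1])
      have hcl : ContinuousOn Real.log (Set.Icc y z) := Real.continuousOn_log.mono (fun t ht => by simp; linarith [ht.1])
      exact (hci.div hcl (fun t ht => (hlog t ht.1).ne')).add (continuousOn_const.mul (hci.div (hcl.pow 2) (fun t ht => by have := hlog t ht.1; positivity)))
  have b5 : C * f y ≤ C / Real.log 2 := by
    simp only [hf, ← div_eq_mul_inv]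
    have := hlog2 y le_rfl
    gcongr
  have b6 : 0 ≤ C * f z := mul_nonneg hC0 (inv_nonneg.2 (hlog z hyz).le)
  linarith

lemma nonprime_summable : ∃ C : ℝ, 0 ≤ C ∧ ∀ F : Finset ℕ,
    ∑ n ∈ F, (if n.Prime then 0 else ArithmeticFunction.vonMangoldt n) / (n : ℝ) ≤ C := by
  have h := ArithmeticFunction.vonMangoldt.summable_residueClass_non_primes_div (q := 1) 1
  have : ArithmeticFunction.vonMangoldt.residueClass (1 : ZMod 1) = fun n => ArithmeticFunction.vonMangoldt n := by
    ext n
    simp [ArithmeticFunction.vonMangoldt.residueClass, Subsingleton.elim (n : ZMod 1) 1]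
  simp only [this] at h
  have hnn : ∀ n : ℕ, 0 ≤ (if n.Prime then 0 else ArithmeticFunction.vonMangoldt n) / (n : ℝ) := by
    intro n
    have := ArithmeticFunction.vonMangoldt_nonneg (n := n)
    split_ifs <;> positivity
  exact ⟨∑' n : ℕ, (if n.Prime then 0 else ArithmeticFunction.vonMangoldt n) / (n : ℝ), tsum_nonneg hnn, fun F => h.sum_le_tsum F (fun n _ => hnn n)⟩

/-- allowed prime powers up to `N` -/
noncomputable def allowedPP (D : ℕ → Prop) (N : ℕ) : Finset ℕ :=
  (Finset.Ioc 0 N).filter (fun q => IsPrimePow q ∧ ∀ p : ℕ, p.Prime → p ∣ q → D p)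

lemma S_bound : ∃ C : ℝ, 0 ≤ C ∧ ∀ x P Q : ℝ, 2 ≤ P → P < Q → Q ≤ x →
    ∑ q ∈ allowedPP (fun p => ¬ (P < (p : ℝ) ∧ (p : ℝ) ≤ Q)) ⌊2 * x⌋₊, 1 / (q : ℝ) ≤
      Real.log (Real.log x) - (Real.log (Real.log Q) - Real.log (Real.log P)) + C := by
  obtain ⟨C1, hC1, h1⟩ := mertens_two
  obtain ⟨C2, hC2, h2⟩ := nonprime_summable
  have hl2 := Real.log_pos one_lt_two
  set h : ℕ → ℝ := fun n => ArithmeticFunction.vonMangoldt n / (n : ℝ) / Real.log n with hh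
  have hnn : ∀ n, 0 ≤ h n := fun n => div_nonneg (div_nonneg ArithmeticFunction.vonMangoldt_nonneg n.cast_nonneg) (Real.log_natCast_nonneg n)
  set A := ∑ n ∈ Finset.Ioc 0 2, h n
  have hA : 0 ≤ A := Finset.sum_nonneg fun n _ => hnn n
  refine ⟨A + 2 * C1 + |Real.log (Real.log 2)| + Real.log 2 + C2 / Real.log 2, by positivity, fun x P Q hP hPQ hQx => ?_⟩
  have pt : ∀ q ∈ allowedPP (fun p => ¬ (P < (p : ℝ) ∧ (p : ℝ) ≤ Q)) ⌊2 * x⌋₊, 1 / (q : ℝ) ≤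
      (if ((q : ℝ) ≤ P ∨ Q < q) then h q else 0) + (Real.log 2)⁻¹ * ((if q.Prime then 0 else ArithmeticFunction.vonMangoldt q) / (q : ℝ)) := by
    intro q hq
    simp only [allowedPP, Finset.mem_filter, Finset.mem_Ioc] at hq
    obtain ⟨⟨hq0, hqN⟩, hpp, hD⟩ := hq
    have hq0' : (0 : ℝ) < q := by exact_mod_cast hq0
    by_cases hp : q.Prime
    · have := hD q hp dvd_rfl
      have hor : (q : ℝ) ≤ P ∨ Q < q := by
        by_contra hcon
        push Not at hcon
        exact this hcon
      rw [if_pos hor, if_pos hp]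
      have hlq : Real.log q ≠ 0 := (Real.log_pos (by exact_mod_cast hp.one_lt)).ne'
      simp only [hh, ArithmeticFunction.vonMangoldt_apply_prime hp]
      apply le_of_eq
      field_simp
      simp
    · rw [if_neg hp]
      have hv : Real.log 2 ≤ ArithmeticFunction.vonMangoldt q := by
        rw [ArithmeticFunction.vonMangoldt_apply, if_pos hpp]
        apply Real.log_le_log (by norm_num)
        exact_mod_cast (Nat.minFac_prime hpp.ne_one).two_le
      have : 1 / (q : ℝ) ≤ (Real.log 2)⁻¹ * (ArithmeticFunction.vonMangoldt q / q) := by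
        rw [← mul_div_assoc]
        gcongr
        rw [inv_mul_eq_div, le_div_iff₀ hl2]
        linarith
      have : 0 ≤ (if ((q : ℝ) ≤ P ∨ Q < q) then h q else 0) := by
        split_ifs
        · exact hnn q
        · exact le_rfl
      linarith
  refine (Finset.sum_le_sum pt).trans ?_
  rw [Finset.sum_add_distrib, ← Finset.mul_sum, ← Finset.sum_filter]
  have t2 : (Real.log 2)⁻¹ * ∑ q ∈ allowedPP (fun p => ¬ (P < (p : ℝ) ∧ (p : ℝ) ≤ Q)) ⌊2 * x⌋₊, ((if q.Prime then 0 else ArithmeticFunction.vonMangoldt q) / (q : ℝ)) ≤ C2 / Real.log 2 := by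
    rw [div_eq_inv_mul]
    exact mul_le_mul_of_nonneg_left (h2 _) (inv_nonneg.2 hl2.le)
  have t1 : ∑ q ∈ (allowedPP (fun p => ¬ (P < (p : ℝ) ∧ (p : ℝ) ≤ Q)) ⌊2 * x⌋₊).filter (fun q : ℕ => (q : ℝ) ≤ P ∨ Q < q), h q ≤
      A + ∑ n ∈ Finset.Ioc ⌊(2 : ℝ)⌋₊ ⌊P⌋₊, h n + ∑ n ∈ Finset.Ioc ⌊Q⌋₊ ⌊2 * x⌋₊, h n := by
    have hsub : (allowedPP (fun p => ¬ (P < (p : ℝ) ∧ (p : ℝ) ≤ Q)) ⌊2 * x⌋₊).filter (fun q : ℕ => (q : ℝ) ≤ P ∨ Q < q) ⊆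
        (Finset.Ioc 0 2 ∪ Finset.Ioc ⌊(2 : ℝ)⌋₊ ⌊P⌋₊) ∪ Finset.Ioc ⌊Q⌋₊ ⌊2 * x⌋₊ := by
      intro q hq
      simp only [allowedPP, Finset.mem_filter, Finset.mem_Ioc] at hq
      obtain ⟨⟨⟨hq0, hqN⟩, _⟩, hor⟩ := hq
      simp only [Finset.mem_union, Finset.mem_Ioc, Nat.floor_ofNat]
      rcases hor with hor | hor
      · have : q ≤ ⌊P⌋₊ := Nat.le_floor hor
        omega
      · have : ⌊Q⌋₊ < q := (Nat.floor_lt (by linarith)).2 hor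
        omega
    refine (Finset.sum_le_sum_of_subset_of_nonneg hsub (fun n _ _ => hnn n)).trans ?_
    have u1 := Finset.sum_union_inter (s₁ := Finset.Ioc 0 2 ∪ Finset.Ioc ⌊(2 : ℝ)⌋₊ ⌊P⌋₊) (s₂ := Finset.Ioc ⌊Q⌋₊ ⌊2 * x⌋₊) (f := h)
    have u2 := Finset.sum_union_inter (s₁ := Finset.Ioc 0 2) (s₂ := Finset.Ioc ⌊(2 : ℝ)⌋₊ ⌊P⌋₊) (f := h)
    have v1 : 0 ≤ ∑ n ∈ (Finset.Ioc 0 2 ∪ Finset.Ioc ⌊(2 : ℝ)⌋₊ ⌊P⌋₊) ∩ Finset.Ioc ⌊Q⌋₊ ⌊2 * x⌋₊, h n := Finset.sum_nonneg fun n _ => hnn n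
    have v2 : 0 ≤ ∑ n ∈ Finset.Ioc 0 2 ∩ Finset.Ioc ⌊(2 : ℝ)⌋₊ ⌊P⌋₊, h n := Finset.sum_nonneg fun n _ => hnn n
    linarith
  have m1 := h1 2 P le_rfl hP
  have m2 := h1 Q (2 * x) (by linarith) (by linarith)
  have m3 : Real.log (Real.log (2 * x)) ≤ Real.log 2 + Real.log (Real.log x) := by
    have hx : 0 < Real.log x := Real.log_pos (by linarith)
    rw [← Real.log_mul two_ne_zero hx.ne']
    apply Real.log_le_log (Real.log_pos (by linarith))
    rw [Real.log_mul two_ne_zero (by linarith)]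
    have := Real.log_le_log two_pos (by linarith : (2 : ℝ) ≤ x)
    linarith
  have m4 := neg_abs_le (Real.log (Real.log 2))
  linarith

noncomputable def Wset (D : ℕ → Prop) (N j : ℕ) : Finset ℕ :=
  (Finset.Ioc 0 N).filter (fun m => m.primeFactors.card = j ∧ ∀ p : ℕ, p.Prime → p ∣ m → D p)

lemma decomp (D : ℕ → Prop) (N j : ℕ) (B : Finset ℕ) (hB : B ⊆ Wset D N (j+1))
    (H : ℕ → ℕ → ℝ) (hH : ∀ m q, 0 ≤ H m q) :
    ∑ n ∈ B, ∑ p ∈ n.primeFactors, H (n / p ^ n.factorization p) (p ^ n.factorization p) ≤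
    ∑ m ∈ Wset D N j, ∑ q ∈ allowedPP D N, if m * q ∈ B then H m q else 0 := by
  rw [Finset.sum_sigma', ← Finset.sum_product']
  have hmem : ∀ a ∈ B.sigma (fun n => n.primeFactors),
      a.1 ≠ 0 ∧ a.1 ∈ Wset D N (j+1) ∧ a.2.Prime ∧ a.2 ∣ a.1 ∧ 
      a.1 / a.2 ^ a.1.factorization a.2 * a.2 ^ a.1.factorization a.2 = a.1 ∧ a.1 ∈ B ∧ a.1.factorization a.2 ≠ 0 := by
    rintro ⟨n, p⟩ h
    simp only [Finset.mem_sigma, Nat.mem_primeFactors] at h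
    obtain ⟨h1, h2, h3, h4⟩ := h
    refine ⟨h4, hB h1, h2, h3, Nat.div_mul_cancel (Nat.ordProj_dvd n p), h1, ?_⟩
    exact (h2.factorization_pos_of_dvd h4 h3).ne'
  rw [Finset.sum_ite, Finset.sum_const_zero, add_zero] 
  let g : (_ : ℕ) × ℕ → ℕ × ℕ := fun a => (a.1 / a.2 ^ a.1.factorization a.2, a.2 ^ a.1.factorization a.2)
  have hinj : Set.InjOn g (B.sigma (fun n => n.primeFactors)) := by
    rintro ⟨n, p⟩ h ⟨n', p'⟩ h' hg
    obtain ⟨a1, a2, a3, a4, a5, a6, a7⟩ := hmem _ h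
    obtain ⟨b1, b2, b3, b4, b5, b6, b7⟩ := hmem _ h'
    simp only [g, Prod.mk.injEq] at hg a1 a2 a3 a4 a5 a6 a7 b1 b2 b3 b4 b5 b6 b7
    have hn : n = n' := by rw [← a5, ← b5, hg.1, hg.2]
    have hp : p = p' := by
      have : p ∣ p' ^ n'.factorization p' := hg.2 ▸ dvd_pow_self p a7
      exact (Nat.prime_dvd_prime_iff_eq a3 b3).1 (a3.dvd_of_dvd_pow this)
    subst hn; subst hp; rfl
  calc _ = ∑ a ∈ B.sigma (fun n => n.primeFactors), (fun b : ℕ × ℕ => H b.1 b.2) (g a) := rfl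
    _ = ∑ b ∈ (B.sigma (fun n => n.primeFactors)).image g, H b.1 b.2 := by
        rw [Finset.sum_image hinj]
    _ ≤ _ := by
        refine Finset.sum_le_sum_of_subset_of_nonneg ?_ (fun b _ _ => hH _ _)
        intro b hb
        rw [Finset.mem_image] at hb
        obtain ⟨⟨n, p⟩, ha, rfl⟩ := hb
        obtain ⟨a1, a2, a3, a4, a5, a6, a7⟩ := hmem _ ha
        simp only [g] at a1 a2 a3 a4 a5 a6 a7 ⊢
        simp only [Finset.mem_filter, Finset.mem_product, a5, a6, and_true]
        simp only [Wset, allowedPP, Finset.mem_filter, Finset.mem_Ioc] at a2 ⊢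
        obtain ⟨⟨c1, c2⟩, c3, c4⟩ := a2
        refine ⟨⟨⟨Nat.pos_of_ne_zero (Nat.ordCompl_pos p a1).ne', (Nat.div_le_self _ _).trans c2⟩, ?_, ?_⟩,
          ⟨Nat.ordProj_pos n p, (Nat.le_of_dvd c1 (Nat.ordProj_dvd n p)).trans c2⟩, ?_, ?_⟩
        · have : (n / p ^ n.factorization p).primeFactors = n.primeFactors.erase p := by
            rw [← Nat.support_factorization, Nat.factorization_ordCompl, Finsupp.support_erase, Nat.support_factorization]
          rw [this, Finset.card_erase_of_mem (Nat.mem_primeFactors.2 ⟨a3, a4, a1⟩), c3]; rfl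
        · intro r hr hd
          exact c4 r hr (hd.trans (Nat.ordCompl_dvd n p))
        · exact a3.isPrimePow.pow a7
        · intro r hr hd
          exact c4 r hr (hd.trans (Nat.ordProj_dvd n p))

lemma A_bound (D : ℕ → Prop) (N j : ℕ) :
    ∑ m ∈ Wset D N j, 1 / (m : ℝ) ≤ (∑ q ∈ allowedPP D N, 1 / (q : ℝ)) ^ j / (j.factorial : ℝ) := by
  induction j with
  | zero =>
    simp only [pow_zero, Nat.factorial_zero, Nat.cast_one, div_one]
    have : Wset D N 0 ⊆ {1} := by
      intro m hm
      simp only [Wset, Finset.mem_filter, Finset.mem_Ioc, Finset.card_eq_zero, Nat.primeFactors_eq_empty] at hm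
      rw [Finset.mem_singleton]; omega
    refine (Finset.sum_le_sum_of_subset_of_nonneg this (fun _ _ _ => by positivity)).trans ?_
    simp
  | succ j ih =>
    have h := decomp D N j (Wset D N (j+1)) le_rfl (fun m q => 1 / ((m : ℝ) * q)) (fun _ _ => by positivity)
    have h1 : ∑ n ∈ Wset D N (j+1), ∑ p ∈ n.primeFactors, (fun m q : ℕ => 1 / ((m : ℝ) * q)) (n / p ^ n.factorization p) (p ^ n.factorization p)
        = (j + 1 : ℝ) * ∑ n ∈ Wset D N (j+1), 1 / (n : ℝ) := by
      rw [Finset.mul_sum]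
      refine Finset.sum_congr rfl fun n hn => ?_
      have : ∀ p ∈ n.primeFactors, (fun m q : ℕ => 1 / ((m : ℝ) * q)) (n / p ^ n.factorization p) (p ^ n.factorization p) = 1 / (n : ℝ) := by
        intro p _
        have : ((n / p ^ n.factorization p : ℕ) : ℝ) * ((p ^ n.factorization p : ℕ) : ℝ) = n := by
          exact_mod_cast Nat.div_mul_cancel (Nat.ordProj_dvd n p)
        simp only [this]
      rw [Finset.sum_congr rfl this, Finset.sum_const, nsmul_eq_mul]
      simp only [Wset, Finset.mem_filter] at hn
      rw [hn.2.1]; push_cast; ring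
    rw [h1] at h
    have h2 : ∑ m ∈ Wset D N j, ∑ q ∈ allowedPP D N, (if m * q ∈ Wset D N (j+1) then 1 / ((m : ℝ) * q) else 0)
        ≤ (∑ m ∈ Wset D N j, 1 / (m : ℝ)) * (∑ q ∈ allowedPP D N, 1 / (q : ℝ)) := by
      rw [Finset.sum_mul_sum]
      refine Finset.sum_le_sum fun m _ => Finset.sum_le_sum fun q _ => ?_
      split_ifs
      · rw [one_div_mul_one_div]
      · positivity
    have hS : 0 ≤ ∑ q ∈ allowedPP D N, 1 / (q : ℝ) := Finset.sum_nonneg fun _ _ => by positivity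
    have h3 := (h.trans h2).trans (mul_le_mul_of_nonneg_right ih hS)
    have hj : (0 : ℝ) < j + 1 := by positivity
    have hf : (0 : ℝ) < j.factorial := by positivity
    rw [Nat.factorial_succ, Nat.cast_mul, le_div_iff₀ (by positivity)]
    push_cast
    rw [div_mul_eq_mul_div, le_div_iff₀ hf, ← pow_succ] at h3
    linarith

lemma log_decomp (n : ℕ) (hn : n ≠ 0) :
    Real.log n = ∑ p ∈ n.primeFactors, Real.log ((p ^ n.factorization p : ℕ) : ℝ) := by
  conv_lhs => rw [← Nat.prod_factorization_pow_eq_self hn]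
  rw [Finsupp.prod, Nat.support_factorization, Nat.cast_prod, Real.log_prod]
  intro p hp
  have := (Nat.prime_of_mem_primeFactors hp).pos
  positivity

lemma count_bound (D : ℕ → Prop) (x : ℝ) (hx : 1 ≤ x) (j : ℕ) :
    ((((Finset.Ioc ⌊x⌋₊ ⌊2*x⌋₊).filter (fun n => n.primeFactors.card = j+1 ∧ ∀ p : ℕ, p.Prime → p ∣ n → D p)).card : ℝ)) * Real.log x
     ≤ ∑ m ∈ Wset D ⌊2*x⌋₊ j, ∑ q ∈ Finset.Ioc ⌊x/m⌋₊ ⌊2*(x/m)⌋₊, ppw q := by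
  set B := (Finset.Ioc ⌊x⌋₊ ⌊2*x⌋₊).filter (fun n => n.primeFactors.card = j+1 ∧ ∀ p : ℕ, p.Prime → p ∣ n → D p) with hBdef
  have hB : B ⊆ Wset D ⌊2*x⌋₊ (j+1) := by
    intro n hn
    simp only [hBdef, Wset, Finset.mem_filter, Finset.mem_Ioc] at hn ⊢
    exact ⟨⟨by omega, hn.1.2⟩, hn.2⟩
  have h := decomp D ⌊2*x⌋₊ j B hB (fun _ q => Real.log q) (fun _ q => Real.log_natCast_nonneg q)
  have h1 : (B.card : ℝ) * Real.log x ≤ ∑ n ∈ B, ∑ p ∈ n.primeFactors, (fun _ q : ℕ => Real.log (q : ℝ)) (n / p ^ n.factorization p) (p ^ n.factorization p) := by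
    rw [← nsmul_eq_mul]
    refine Finset.card_nsmul_le_sum _ _ _ fun n hn => ?_
    have hn2 : x < n := by
      simp only [hBdef, Finset.mem_filter, Finset.mem_Ioc] at hn
      exact (Nat.floor_lt (by linarith)).1 hn.1.1
    have hn0 : n ≠ 0 := by rintro rfl; simp at hn2; linarith
    simp only [← log_decomp n hn0]
    exact Real.log_le_log (by linarith) hn2.le
  refine (h1.trans h).trans (Finset.sum_le_sum fun m hm => ?_)
  rw [← Finset.sum_filter]
  simp only [Wset, Finset.mem_filter, Finset.mem_Ioc] at hm
  have hm0 : (0 : ℝ) < m := by exact_mod_cast hm.1.1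
  have hsub : (allowedPP D ⌊2*x⌋₊).filter (fun q => m * q ∈ B) ⊆ Finset.Ioc ⌊x/m⌋₊ ⌊2*(x/m)⌋₊ := by
    intro q hq
    simp only [hBdef, Finset.mem_filter, Finset.mem_Ioc] at hq ⊢
    obtain ⟨_, ⟨h1, h2⟩, _⟩ := hq
    rw [Nat.floor_lt (by linarith)] at h1
    rw [Nat.le_floor_iff (by linarith)] at h2
    push_cast at h1 h2
    rw [Nat.floor_lt (by positivity), Nat.le_floor_iff (by positivity), div_lt_iff₀ hm0, ← mul_div_assoc, le_div_iff₀ hm0]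
    constructor <;> linarith
  refine le_trans (le_of_eq ?_) (Finset.sum_le_sum_of_subset_of_nonneg hsub fun q _ _ => ppw_nonneg q)
  refine Finset.sum_congr rfl fun q hq => ?_
  simp only [allowedPP, Finset.mem_filter] at hq
  simp only [ppw, if_pos hq.1.2.1]

lemma harm_Ioc (a : ℝ) (y0 : ℝ) (hy : 1 ≤ y0) (ha : 0 < a) (s : Finset ℕ) (hs : ∀ m ∈ s, a / y0 ≤ (m : ℝ) ∧ (m : ℝ) ≤ 2 * a ∧ 0 < m) :
    ∑ m ∈ s, 1 / (m : ℝ) ≤ 2 * y0 := by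
  have h1 : ∀ m ∈ s, 1 / (m : ℝ) ≤ y0 / a := by
    intro m hm
    obtain ⟨h1, h2, h3⟩ := hs m hm
    have : (0 : ℝ) < m := by exact_mod_cast h3
    rw [div_le_div_iff₀ this ha]
    rw [div_le_iff₀ (by linarith)] at h1
    linarith
  have h2 := Finset.sum_le_card_nsmul _ _ _ h1
  have h3 : s ⊆ Finset.Ioc 0 ⌊2*a⌋₊ := by
    intro m hm
    obtain ⟨h1, h2, h3⟩ := hs m hm
    rw [Finset.mem_Ioc]
    exact ⟨h3, Nat.le_floor h2⟩
  have h4 : (s.card : ℝ) ≤ 2 * a := by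
    have := Finset.card_le_card h3
    rw [Nat.card_Ioc, Nat.sub_zero] at this
    exact (Nat.cast_le.2 this).trans (Nat.floor_le (by linarith))
  refine h2.trans ?_
  rw [nsmul_eq_mul]
  calc (s.card : ℝ) * (y0 / a) ≤ 2 * a * (y0 / a) := by gcongr
    _ = 2 * y0 := by field_simp

/-- main combinatorial bound -/
lemma main_count (ε : ℝ) (hε : 0 < ε) : ∃ C y0 : ℝ, 0 ≤ C ∧ 1 ≤ y0 ∧ ∀ (D : ℕ → Prop) (x : ℝ) (j : ℕ), y0 ≤ x →
    ((((Finset.Ioc ⌊x⌋₊ ⌊2*x⌋₊).filter (fun n => n.primeFactors.card = j+1 ∧ ∀ p : ℕ, p.Prime → p ∣ n → D p)).card : ℝ)) * Real.log x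
     ≤ x * ((1 + ε) * ((∑ q ∈ allowedPP D ⌊2*x⌋₊, 1 / (q : ℝ)) ^ j / (j.factorial : ℝ)) + if j = 0 then 0 else C) := by
  obtain ⟨y0, hy0, hd⟩ := ppw_dyadic ε hε
  obtain ⟨C, hC, hc⟩ := ppw_cheb
  refine ⟨C * (2 * y0), y0, by positivity, hy0, fun D x j hx => ?_⟩
  have hx0 : 0 < x := by linarith
  refine (count_bound D x (by linarith) j).trans ?_
  rw [← Finset.sum_filter_add_sum_filter_not _ (fun m : ℕ => (m : ℝ) ≤ x / y0), mul_add]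
  have hW : ∀ m ∈ Wset D ⌊2*x⌋₊ j, 0 < m ∧ (m : ℝ) ≤ 2 * x ∧ m.primeFactors.card = j := by
    intro m hm
    simp only [Wset, Finset.mem_filter, Finset.mem_Ioc] at hm
    exact ⟨hm.1.1, (Nat.le_floor_iff (by linarith)).1 hm.1.2, hm.2.1⟩
  refine add_le_add ?_ ?_
  · calc _ ≤ ∑ m ∈ (Wset D ⌊2*x⌋₊ j).filter (fun m : ℕ => (m : ℝ) ≤ x / y0), x * ((1 + ε) * (1 / (m : ℝ))) := by
          refine Finset.sum_le_sum fun m hm => ?_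
          rw [Finset.mem_filter] at hm
          have hm0 : (0 : ℝ) < m := by exact_mod_cast (hW m hm.1).1
          refine (hd (x / m) ?_).trans (le_of_eq (by ring))
          have := hm.2
          rw [le_div_iff₀ (by linarith)] at this ⊢
          linarith
      _ ≤ ∑ m ∈ (Wset D ⌊2*x⌋₊ j), x * ((1 + ε) * (1 / (m : ℝ))) :=
          Finset.sum_le_sum_of_subset_of_nonneg (Finset.filter_subset _ _) (fun _ _ _ => by positivity)
      _ ≤ _ := by
          rw [← Finset.mul_sum, ← Finset.mul_sum]
          have := A_bound D ⌊2*x⌋₊ j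
          gcongr
  · split_ifs with hj
    · rw [mul_zero]
      refine le_of_eq (Finset.sum_eq_zero fun m hm => ?_)
      exfalso
      rw [Finset.mem_filter] at hm
      obtain ⟨h1, h2, h3⟩ := hW m hm.1
      rw [hj, Finset.card_eq_zero, Nat.primeFactors_eq_empty] at h3
      have : m = 1 := by omega
      apply hm.2
      rw [this, le_div_iff₀ (by linarith)]; simpa using hx
    · calc _ ≤ ∑ m ∈ (Wset D ⌊2*x⌋₊ j).filter (fun m : ℕ => ¬ (m : ℝ) ≤ x / y0), x * (C * (1 / (m : ℝ))) := by
            refine Finset.sum_le_sum fun m hm => ?_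
            refine (hc (x / m) (by positivity)).trans (le_of_eq (by ring))
        _ ≤ _ := by
            rw [← Finset.mul_sum, ← Finset.mul_sum]
            have := harm_Ioc x y0 hy0 hx0 ((Wset D ⌊2*x⌋₊ j).filter (fun m : ℕ => ¬ (m : ℝ) ≤ x / y0)) (fun m hm => by
              rw [Finset.mem_filter] at hm
              obtain ⟨h1, h2, h3⟩ := hW m hm.1
              exact ⟨(not_le.1 hm.2).le, h2, h1⟩)
            gcongr

lemma lam_factor (z : ℝ) (h0 : 0 ≤ z) (h1 : z ≤ 1) (p : ℝ) (hp : 2 ≤ p) :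
    1 ≤ (1 + z / (p - 1)) * (1 - 1 / p) ^ z := by
  have hb := rpow_one_add_le_one_add_mul_self (s := 1 / (p - 1))
    (by have : 0 ≤ 1 / (p - 1) := by apply div_nonneg <;> linarith
        linarith) h0 h1
  have hpos : 0 < (1 - 1 / p) := by
    have : 1 / p ≤ 1 / 2 := by gcongr
    linarith
  have e : (1 + 1 / (p - 1)) = (1 - 1 / p)⁻¹ := by
    have : p - 1 ≠ 0 := by linarith
    have : p ≠ 0 := by linarith
    field_simp
    ring
  rw [e, Real.inv_rpow hpos.le] at hb
  have hq := Real.rpow_pos_of_pos hpos z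
  have e2 : 1 + z / (p - 1) = 1 + z * (1 / (p - 1)) := by ring
  rw [e2]
  calc (1 : ℝ) = ((1 - 1 / p) ^ z)⁻¹ * (1 - 1 / p) ^ z := (inv_mul_cancel₀ hq.ne').symm
    _ ≤ _ := mul_le_mul_of_nonneg_right hb hq.le

lemma lambda_ge_one (z : ℝ) (h0 : 0 ≤ z) (h1 : z ≤ 1) : 1 ≤ lambdaFn z := by
  unfold lambdaFn
  have hG : Real.Gamma (z + 1) ≤ 1 := by
    have := Real.convexOn_Gamma.2 (show (1:ℝ) ∈ Set.Ioi 0 by simp) (show (2:ℝ) ∈ Set.Ioi 0 by simp)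
      (show 0 ≤ 1 - z by linarith) h0 (by ring)
    simp only [smul_eq_mul, Real.Gamma_one, Real.Gamma_two] at this
    have e : (1 - z) * 1 + z * 2 = z + 1 := by ring
    rw [e] at this
    linarith
  have hGp : 0 < Real.Gamma (z + 1) := Real.Gamma_pos_of_pos (by linarith)
  have hP : 1 ≤ ∏' p : Nat.Primes, ((1 + z / (((p : ℕ) : ℝ) - 1)) * (1 - 1 / ((p : ℕ) : ℝ)) ^ z) := by
    have hf : ∀ p : Nat.Primes, 1 ≤ ((1 + z / (((p : ℕ) : ℝ) - 1)) * (1 - 1 / ((p : ℕ) : ℝ)) ^ z) :=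
      fun p => lam_factor z h0 h1 _ (by exact_mod_cast p.2.two_le)
    by_cases hm : Multipliable (fun p : Nat.Primes => ((1 + z / (((p : ℕ) : ℝ) - 1)) * (1 - 1 / ((p : ℕ) : ℝ)) ^ z))
    · refine ge_of_tendsto hm.hasProd (Filter.Eventually.of_forall fun s => ?_)
      exact Finset.one_le_prod fun i _ => hf i
    · rw [tprod_eq_one_of_not_multipliable hm]
  have := (one_le_inv₀ hGp).2 hG
  nlinarith

lemma final_real (l L C C' S e1 u : ℝ) (j : ℕ) (hC : 0 ≤ C) (hC' : 0 ≤ C') (he1 : 0 < e1)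
    (hu : 0 < u) (hl : 1 ≤ l) (hL : L ≤ 2 * l) (hS : 0 ≤ S) (hSL : S ≤ l - L + C)
    (hj : (j : ℝ) ≤ u * l) (hu1 : u * Real.exp 2 ≤ 1) (hu2 : C * u ≤ Real.log (1 + e1))
    (hu3 : C' * (u * Real.exp 2) ≤ e1) :
    (1 + e1) * (S ^ j / (j.factorial : ℝ)) + (if j = 0 then 0 else C') ≤
      ((1 + e1) * (1 + e1) + e1) * (l ^ j / (j.factorial : ℝ) * Real.exp (-(L * (j / l)))) := by
  have hl0 : 0 < l := by linarith
  have hf : (0 : ℝ) < j.factorial := by positivity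
  set T := l ^ j / (j.factorial : ℝ) * Real.exp (-(L * (j / l))) with hT
  have hκ : (j : ℝ) / l ≤ u := by rw [div_le_iff₀ hl0]; exact hj
  have hT0 : 0 < T := by positivity
  have h1 : S ^ j / (j.factorial : ℝ) ≤ (1 + e1) * T := by
    have hb : S ≤ l * Real.exp (-(L - C) / l) := by
      have := Real.add_one_le_exp (-(L - C) / l)
      have h2 := mul_le_mul_of_nonneg_left this hl0.le
      have e : l * (-(L - C) / l + 1) = l - L + C := by field_simp; ring
      linarith
    have h3 := pow_le_pow_left₀ hS hb j
    rw [mul_pow, ← Real.exp_nat_mul] at h3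
    have e : (j : ℝ) * (-(L - C) / l) = -(L * (j / l)) + C * (j / l) := by field_simp; ring
    rw [e, Real.exp_add] at h3
    have h4 : Real.exp (C * (j / l)) ≤ 1 + e1 := by
      rw [← Real.le_log_iff_exp_le (by linarith)]
      exact (mul_le_mul_of_nonneg_left hκ hC).trans hu2
    rw [div_le_iff₀ hf]
    refine h3.trans ?_
    have e3 : (1 + e1) * T * (j.factorial : ℝ) = l ^ j * (Real.exp (-(L * (j / l))) * (1 + e1)) := by
      rw [hT]; field_simp
    rw [e3]
    gcongr
  have h2 : (if j = 0 then 0 else C') ≤ e1 * T := by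
    split_ifs with h0
    · positivity
    · have hj0 : (0 : ℝ) < j := by exact_mod_cast Nat.pos_of_ne_zero h0
      have hE := Real.exp_pos 2
      have hue : 0 < u * Real.exp 2 := by positivity
      have hTb : 1 / (u * Real.exp 2) ≤ T := by
        calc 1 / (u * Real.exp 2) ≤ (1 / (u * Real.exp 2)) ^ j :=
              le_self_pow₀ ((one_le_div hue).2 hu1) h0
          _ ≤ (l / (j * Real.exp 2)) ^ j := by
              gcongr ?_ ^ j
              rw [div_le_div_iff₀ hue (by positivity)]
              nlinarith
          _ = l ^ j / (j : ℝ) ^ j * Real.exp (-(2 * j)) := by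
              rw [div_pow, mul_pow, ← Real.exp_nat_mul, Real.exp_neg, mul_comm (2 : ℝ)]
              field_simp
          _ ≤ T := by
              rw [hT]
              have hx : L * (j / l) ≤ 2 * j := by
                rw [← mul_div_assoc, div_le_iff₀ hl0]
                nlinarith
              have hx2 := Real.exp_le_exp.2 (neg_le_neg hx)
              have hx3 : l ^ j / (j : ℝ) ^ j ≤ l ^ j / (j.factorial : ℝ) := by
                gcongr
                exact_mod_cast Nat.factorial_le_pow j
              exact mul_le_mul hx3 hx2 (Real.exp_pos _).le (by positivity)
      have := mul_le_mul_of_nonneg_left hTb he1.le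
      refine le_trans ?_ this
      rw [mul_one_div, le_div_iff₀ hue]; exact hu3
  have h3 := mul_le_mul_of_nonneg_left h1 (by linarith : 0 ≤ 1 + e1)
  linarith

set_option maxHeartbeats 1000000 in
theorem stmt10 (ε : ℝ) (hε : 0 < ε) :
    ∃ η : ℝ, 0 < η ∧ ∃ x₀ : ℝ, 3 ≤ x₀ ∧ ∀ x : ℝ, x₀ ≤ x →
      ∀ k : ℕ, 1 ≤ k → (k : ℝ) ≤ η * Real.sqrt (log₂ x) →
      ∀ P Q : ℝ, 2 ≤ P → P < Q → Q ≤ x →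
      (((Finset.Ioc ⌊x⌋₊ ⌊2 * x⌋₊).filter
          (fun n => smallOmega n = k ∧
            ∀ p : ℕ, p.Prime → P < (p : ℝ) → (p : ℝ) ≤ Q → ¬ p ∣ n)).card : ℝ)
        ≤ (1 + ε) * (deltak k x * x *
            (Real.log P / Real.log Q) ^ (((k : ℝ) - 1) / log₂ x)) := by
  set e1 : ℝ := min ε 1 / 4 with he1
  have hm1 := min_le_left ε 1
  have hm2 := min_le_right ε 1
  have hm0 : 0 < min ε 1 := lt_min hε one_pos
  have he0 : 0 < e1 := by positivity
  have hee : (1 + e1) * (1 + e1) + e1 ≤ 1 + ε := by nlinarith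
  obtain ⟨C, hC, hSb⟩ := S_bound
  obtain ⟨C', y0, hC', hy0, hcount⟩ := main_count e1 he0
  have hlog1 : 0 < Real.log (1 + e1) := Real.log_pos (by linarith)
  have hE := Real.exp_pos 2
  obtain ⟨u, hu0, hu1, hu2, hu3⟩ : ∃ u : ℝ, 0 < u ∧ u * Real.exp 2 ≤ 1 ∧ C * u ≤ Real.log (1 + e1) ∧
      C' * (u * Real.exp 2) ≤ e1 := by
    refine ⟨min (Real.exp 2)⁻¹ (min (Real.log (1 + e1) / (C + 1)) (e1 / ((C' + 1) * Real.exp 2))),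
      by positivity, ?_, ?_, ?_⟩
    · rw [← le_div_iff₀ hE, one_div]; exact min_le_left _ _
    · have h := (min_le_right (Real.exp 2)⁻¹ (min (Real.log (1 + e1) / (C + 1)) (e1 / ((C' + 1) * Real.exp 2)))).trans (min_le_left _ _)
      have h0 : 0 < min (Real.exp 2)⁻¹ (min (Real.log (1 + e1) / (C + 1)) (e1 / ((C' + 1) * Real.exp 2))) := by positivity
      rw [le_div_iff₀ (by linarith)] at h
      nlinarith
    · have h := (min_le_right (Real.exp 2)⁻¹ (min (Real.log (1 + e1) / (C + 1)) (e1 / ((C' + 1) * Real.exp 2)))).trans (min_le_right _ _)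
      have h0 : 0 < min (Real.exp 2)⁻¹ (min (Real.log (1 + e1) / (C + 1)) (e1 / ((C' + 1) * Real.exp 2))) := by positivity
      generalize min (Real.exp 2)⁻¹ (min (Real.log (1 + e1) / (C + 1)) (e1 / ((C' + 1) * Real.exp 2))) = v at h h0 ⊢
      rw [le_div_iff₀ (by positivity)] at h
      have := mul_pos h0 hE
      nlinarith
  refine ⟨Real.sqrt u, Real.sqrt_pos.2 hu0, max 3 y0, le_max_left _ _, fun x hx k hk hkη P Q hP hPQ hQ => ?_⟩
  have hx3 : 3 ≤ x := (le_max_left _ _).trans hx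
  have hxy : y0 ≤ x := (le_max_right _ _).trans hx
  have hx0 : 0 < x := by linarith
  have hlogx : 0 < Real.log x := Real.log_pos (by linarith)
  obtain ⟨j, rfl⟩ : ∃ j, k = j + 1 := ⟨k - 1, by omega⟩
  have hkk : (((j + 1 : ℕ) : ℝ) - 1) = j := by push_cast; ring
  rw [hkk]
  set l := log₂ x with hl
  have hu_le : u ≤ 1 := by
    have : 1 ≤ Real.exp 2 := Real.one_le_exp (by norm_num)
    nlinarith
  have hk1 : (1 : ℝ) ≤ ((j + 1 : ℕ) : ℝ) := by exact_mod_cast hk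
  have hsq : (((j + 1 : ℕ) : ℝ)) ^ 2 ≤ u * l := by
    have h := hkη
    rw [← Real.sqrt_mul hu0.le] at h
    have hpos : 0 < u * l := by
      by_contra hn
      rw [Real.sqrt_eq_zero_of_nonpos (not_lt.1 hn)] at h
      linarith
    exact (Real.le_sqrt' (by linarith)).1 h
  have hul : 1 ≤ u * l := by nlinarith
  have hl1 : 1 ≤ l := by
    by_contra hn
    push Not at hn
    nlinarith
  have hj : (j : ℝ) ≤ u * l := by push_cast at hsq; nlinarith [(Nat.cast_nonneg j : (0:ℝ) ≤ j)]
  set L := Real.log (Real.log Q) - Real.log (Real.log P) with hLdef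
  have hlogP : 0 < Real.log P := Real.log_pos (by linarith)
  have hlogQ : 0 < Real.log Q := Real.log_pos (by linarith)
  have hL : L ≤ 2 * l := by
    have h1 : Real.log (Real.log Q) ≤ l := Real.log_le_log hlogQ (Real.log_le_log (by linarith) hQ)
    have h2 : -1 ≤ Real.log (Real.log P) := by
      have h3 : Real.log 2 ≤ Real.log P := Real.log_le_log (by norm_num) hP
      have h4 := Real.log_two_gt_d9
      have h5 : Real.exp (-1) ≤ Real.log P := by
        have := Real.exp_neg_one_lt_d9
        linarith
      rw [Real.le_log_iff_exp_le hlogP]; exact h5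
    linarith
  set D : ℕ → Prop := fun p => ¬ (P < (p:ℝ) ∧ (p:ℝ) ≤ Q) with hD
  have hSx := hSb x P Q hP hPQ hQ
  set S := ∑ q ∈ allowedPP D ⌊2*x⌋₊, 1 / (q : ℝ) with hSdef
  have hS0 : 0 ≤ S := Finset.sum_nonneg fun _ _ => by positivity
  have hmain := hcount D x j hxy
  have hreal := final_real l L C C' S e1 u j hC hC' he0 hu0 hl1 hL hS0 hSx hj hu1 hu2 hu3
  have hset : (Finset.Ioc ⌊x⌋₊ ⌊2 * x⌋₊).filter
          (fun n => smallOmega n = j + 1 ∧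
            ∀ p : ℕ, p.Prime → P < (p : ℝ) → (p : ℝ) ≤ Q → ¬ p ∣ n) =
      (Finset.Ioc ⌊x⌋₊ ⌊2*x⌋₊).filter (fun n => n.primeFactors.card = j+1 ∧ ∀ p : ℕ, p.Prime → p ∣ n → D p) := by
    refine Finset.filter_congr fun n _ => ?_
    simp only [smallOmega, hD]
    refine and_congr Iff.rfl ⟨fun h p hp hd hh => h p hp hh.1 hh.2 hd, fun h p hp h1 h2 hd => h p hp hd ⟨h1, h2⟩⟩
  rw [hset]
  set cnt : ℝ := (((Finset.Ioc ⌊x⌋₊ ⌊2*x⌋₊).filter (fun n => n.primeFactors.card = j+1 ∧ ∀ p : ℕ, p.Prime → p ∣ n → D p)).card : ℝ)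
  have hpow : (Real.log P / Real.log Q) ^ ((j : ℝ) / l) = Real.exp (-(L * (j / l))) := by
    rw [Real.rpow_def_of_pos (by positivity), Real.log_div hlogP.ne' hlogQ.ne', hLdef]
    congr 1; ring
  have hlam : 1 ≤ lambdaFn ((j : ℝ) / l) := by
    refine lambda_ge_one _ (by positivity) ?_
    rw [div_le_one (by linarith)]
    exact hj.trans (mul_le_of_le_one_left (by linarith) hu_le)
  rw [hpow]
  set T := l ^ j / (j.factorial : ℝ) * Real.exp (-(L * (j / l))) with hT
  have hT0 : 0 < T := by positivity
  have hdel : deltak (j + 1) x * x * Real.exp (-(L * (j / l))) = lambdaFn ((j : ℝ) / l) * (x / Real.log x * T) := by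
    unfold deltak
    rw [hkk, ← hl, Nat.add_sub_cancel, hT]
    field_simp
  rw [hdel]
  calc cnt ≤ x * (((1 + e1) * (1 + e1) + e1) * T) / Real.log x := by
        rw [le_div_iff₀ hlogx]
        exact hmain.trans (mul_le_mul_of_nonneg_left hreal hx0.le)
    _ = ((1 + e1) * (1 + e1) + e1) * (x / Real.log x * T) := by ring
    _ ≤ (1 + ε) * (x / Real.log x * T) := by gcongr
    _ ≤ (1 + ε) * (lambdaFn ((j : ℝ) / l) * (x / Real.log x * T)) := by
        have : 0 < x / Real.log x * T := by positivity
        exact mul_le_mul_of_nonneg_left (le_mul_of_one_le_left this.le hlam) (by linarith)
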